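/- arXiv:1710.08943 — 3 statements merged into one kernel-verified Lean document; each statement's English description precedes it below -/
import Mathlib

section
/- Let n ≥ 3, let χ be a 2-dimensional algebra structure with χ(e_1,e_1) = c_{11}e_1 + e_2, χ(e_1,e_2) = c_{12}e_1 + d_{12}e_2, χ(e_2,e_1) = c_{21}e_1 + d_{21}e_2, χ(e_2,e_2) = d_{22}e_2 where d_{22} ∈ {0,1}, let L_1,R_1,L_2,R_2 ∈ M_{n−2}(k), and let μ = k^{n−2}⋊_{(L_1,R_1,L_2,R_2)}χ ∈ A_n. Set S = L_1 + R_1 − c_{11}·Id. Then G(μ) = 2 if and only if L_2 = (d_{21}·Id − R_1)S + c_{21}·Id, R_2 = (d_{12}·Id − L_1)S + c_{12}·Id, and S³ + (c_{11} − d_{12} − d_{21})S² + (d_{22} − c_{12} − c_{21})S = 0. -/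
open scoped BigOperators

noncomputable section

/-- The space of `n`-dimensional (nonassociative) algebra structures on `kⁿ`:
bilinear maps `kⁿ × kⁿ → kⁿ`. -/
abbrev AlgStr (k : Type*) [Field k] (n : ℕ) : Type _ :=
  (Fin n → k) →ₗ[k] (Fin n → k) →ₗ[k] (Fin n → k)

variable {k : Type*} [Field k]

/-- The algebra structure with prescribed structure constants `c`:
`μ(x, y) m = ∑ i, ∑ j, x i * y j * c i j m`. -/
def ofConst {n : ℕ} (c : Fin n → Fin n → Fin n → k) : AlgStr k n :=
  ∑ i, ∑ j,
    ((LinearMap.mul k k).compl₁₂ (LinearMap.proj i) (LinearMap.proj j)).compr₂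
      (LinearMap.toSpanSingleton k (Fin n → k) (c i j))

/-- The structure constants of an algebra structure in the standard basis. -/
def structConst {n : ℕ} (μ : AlgStr k n) : Fin n × Fin n × Fin n → k :=
  fun t => μ (Pi.single t.1 1) (Pi.single t.2.1 1) t.2.2

/-- A subset of `AlgStr k n` is Zariski closed if it is the common zero locus of a
family of polynomials in the structure constants. -/
def IsZariskiClosed {n : ℕ} (S : Set (AlgStr k n)) : Prop :=
  ∃ P : Set (MvPolynomial (Fin n × Fin n × Fin n) k),
    ∀ μ : AlgStr k n, μ ∈ S ↔ ∀ p ∈ P, MvPolynomial.eval (structConst μ) p = 0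

/-- The action of `GL(V)` on algebra structures: `(g • μ)(x,y) = g (μ (g⁻¹ x) (g⁻¹ y))`. -/
def transport {n : ℕ} (g : (Fin n → k) ≃ₗ[k] (Fin n → k)) (μ : AlgStr k n) :
    AlgStr k n :=
  ((μ.comp g.symm.toLinearMap).compl₂ g.symm.toLinearMap).compr₂ g.toLinearMap

/-- The `GL(V)`-orbit of an algebra structure; two structures represent isomorphic
algebras iff they lie in the same orbit. -/
def orbit {n : ℕ} (μ : AlgStr k n) : Set (AlgStr k n) :=
  {χ | ∃ g : (Fin n → k) ≃ₗ[k] (Fin n → k), transport g μ = χ}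

/-- The Zariski closure of a set of algebra structures. -/
def zclosure {n : ℕ} (S : Set (AlgStr k n)) : Set (AlgStr k n) :=
  {χ | ∀ T : Set (AlgStr k n), IsZariskiClosed T → S ⊆ T → χ ∈ T}

/-- `μ` degenerates to `χ` if `χ` lies in the Zariski closure of the orbit of `μ`. -/
def degenerates {n : ℕ} (μ χ : AlgStr k n) : Prop :=
  χ ∈ zclosure (orbit μ)

/-- A proper degeneration: additionally `χ` is not isomorphic to `μ`. -/
def properlyDegenerates {n : ℕ} (μ χ : AlgStr k n) : Prop :=
  degenerates μ χ ∧ χ ∉ orbit μ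

/-- There is a chain of `m` proper degenerations starting at `μ`. -/
def hasChain {n : ℕ} (μ : AlgStr k n) (m : ℕ) : Prop :=
  ∃ c : ℕ → AlgStr k n, c m = μ ∧ ∀ i < m, properlyDegenerates (c (i + 1)) (c i)

/-- The level of `μ` is `m`: there is a chain of `m` proper degenerations starting
at `μ` but no chain of `m+1`. -/
def levelIs {n : ℕ} (μ : AlgStr k n) (m : ℕ) : Prop :=
  hasChain μ m ∧ ¬ hasChain μ (m + 1)

/-- The subalgebra generated by a set `s`. -/
def subalgGen {n : ℕ} (μ : AlgStr k n) (s : Set (Fin n → k)) :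
    Submodule k (Fin n → k) :=
  sInf {W | s ⊆ W ∧ ∀ x ∈ W, ∀ y ∈ W, μ x y ∈ W}

/-- The generation type of `μ` is `m`: `m` is the maximal dimension of a
one-generated subalgebra. -/
def genType {n : ℕ} (μ : AlgStr k n) (m : ℕ) : Prop :=
  IsGreatest {d : ℕ | ∃ a : Fin n → k, Module.finrank k ↥(subalgGen μ {a}) = d} m

/-- A standard `1`-generated algebra: it admits a grading `A = ⊕_{i ≥ 1} A_i` with
`dim A_1 = 1`, `A_i A_j ⊆ A_{i+j}`, generated by `A_1` as an algebra. -/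
def StandardOneGenerated {m : ℕ} (μ : AlgStr k m) : Prop :=
  ∃ A : ℕ → Submodule k (Fin m → k),
    A 0 = ⊥ ∧ DirectSum.IsInternal A ∧ Module.finrank k ↥(A 1) = 1 ∧
    (∀ i j : ℕ, ∀ x ∈ A i, ∀ y ∈ A j, μ x y ∈ A (i + j)) ∧
    subalgGen μ ((A 1 : Submodule k (Fin m → k)) : Set (Fin m → k)) = ⊤

/-- Extension by zero of coordinates, `kᵐ → kⁿ`. -/
def inclMap (k : Type*) [Field k] {m n : ℕ} (h : m ≤ n) :
    (Fin m → k) →ₗ[k] (Fin n → k) where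
  toFun x i := if hi : (i : ℕ) < m then x ⟨i, hi⟩ else 0
  map_add' x y := by funext i; by_cases hi : (i : ℕ) < m <;> simp [hi]
  map_smul' a x := by funext i; by_cases hi : (i : ℕ) < m <;> simp [hi]

/-- The `n`-dimensional algebra `B ⊕ k^{n-m}` obtained from an `m`-dimensional
algebra `B` by adjoining a complement with all products zero. -/
def extendZero {m n : ℕ} (h : m ≤ n) (B : AlgStr k m) : AlgStr k n :=
  ((B.comp (LinearMap.funLeft k k (Fin.castLE h))).compl₂
      (LinearMap.funLeft k k (Fin.castLE h))).compr₂ (inclMap k h)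

/-- The `i`-th standard basis vector (as a plain function, `0` if `i ≥ n`). -/
def unitVec {k : Type*} [Field k] (n i : ℕ) : Fin n → k :=
  fun j => if (j : ℕ) = i then 1 else 0

/-- Projection onto the coordinate `0` part. -/
def proj0 (k : Type*) [Field k] (n : ℕ) : (Fin n → k) →ₗ[k] (Fin n → k) :=
  LinearMap.pi fun i => if (i : ℕ) = 0 then LinearMap.proj i else 0

/-- Projection onto the coordinates `≥ 1` part. -/
def projPos (k : Type*) [Field k] (n : ℕ) : (Fin n → k) →ₗ[k] (Fin n → k) :=
  LinearMap.pi fun i => if (i : ℕ) = 0 then 0 else LinearMap.proj i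

/-- The Inönü–Wigner contraction of `μ` with respect to the `1`-dimensional
subalgebra spanned by the first basis vector (the remaining coordinates form the
square-zero ideal part). -/
def IWcontract0 {n : ℕ} (μ : AlgStr k n) : AlgStr k n :=
  ((μ.comp (projPos k n)).compl₂ (proj0 k n)).compr₂ (projPos k n) +
    ((μ.comp (proj0 k n)).compl₂ (projPos k n)).compr₂ (projPos k n) +
    (μ.comp (proj0 k n)).compl₂ (proj0 k n)

/-- The annihilator of an algebra structure. -/
def annihilator {n : ℕ} (μ : AlgStr k n) : Submodule k (Fin n → k) where
  carrier := {a | ∀ b, μ a b = 0 ∧ μ b a = 0}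
  add_mem' := by
    intro a b ha hb
    intro c
    constructor
    · rw [map_add, LinearMap.add_apply, (ha c).1, (hb c).1, add_zero]
    · rw [map_add, (ha c).2, (hb c).2, add_zero]
  zero_mem' := by
    intro b
    constructor
    · rw [map_zero, LinearMap.zero_apply]
    · rw [map_zero]
  smul_mem' := by
    intro t a ha b
    constructor
    · rw [map_smul, LinearMap.smul_apply, (ha b).1, smul_zero]
    · rw [map_smul, (ha b).2, smul_zero]

/-- `μ` has a square-zero (two-sided) ideal of codimension `1`. -/
def hasSqZeroIdealCodim1 {n : ℕ} (μ : AlgStr k n) : Prop :=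
  ∃ I : Submodule k (Fin n → k), Module.finrank k ↥I = n - 1 ∧
    (∀ x ∈ I, ∀ y : Fin n → k, μ x y ∈ I ∧ μ y x ∈ I) ∧
    ∀ x ∈ I, ∀ y ∈ I, μ x y = 0

/-- `a` (viewed as the sequence of parts `a 0 ≥ a 1 ≥ …`) is a partition of `N`. -/
def IsPartitionOf (a : ℕ → ℕ) (N : ℕ) : Prop :=
  (∀ i j : ℕ, i ≤ j → a j ≤ a i) ∧
    ∃ l : ℕ, (∀ i, l ≤ i → a i = 0) ∧ ∑ i ∈ Finset.range l, a i = N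

/-- The dominance order on partitions: `a ⪰ b`. -/
def Dominates (a b : ℕ → ℕ) : Prop :=
  ∀ m : ℕ, ∑ i ∈ Finset.range m, b i ≤ ∑ i ∈ Finset.range m, a i

/-- `a` is the Jordan type of the matrix `M` at the eigenvalue `lam`:
`a` is a partition of the generalized eigenspace dimension, and the parts of `a`
are the sizes of the Jordan blocks of `M` with eigenvalue `lam`, expressed via
the ranks of powers of `M - lam • 1`. -/
def IsJordanTypeAt {N : ℕ} (M : Matrix (Fin N) (Fin N) k) (lam : k) (a : ℕ → ℕ) :
    Prop :=
  IsPartitionOf a (N - ((M - lam • (1 : Matrix (Fin N) (Fin N) k)) ^ N).rank) ∧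
    ∀ p : ℕ, ((M - lam • (1 : Matrix (Fin N) (Fin N) k)) ^ p).rank =
      N - ∑ i ∈ Finset.range N, min (a i) p

/-- The full specter of `M` is `{(lam i, a i)}`: the `lam i` are pairwise distinct,
each `a i` is the (nonempty) Jordan type of `M` at `lam i`, and every eigenvalue
of `M` occurs among the `lam i`. -/
def IsFullSpecter {N : ℕ} (M : Matrix (Fin N) (Fin N) k) {l : ℕ}
    (lam : Fin l → k) (a : Fin l → ℕ → ℕ) : Prop :=
  Function.Injective lam ∧
    (∀ i, IsJordanTypeAt M (lam i) (a i) ∧ a i 0 ≠ 0) ∧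
    ∀ c : k, (∃ v : Fin N → k, v ≠ 0 ∧ M.mulVec v = c • v) → ∃ i, lam i = c

/-- There is a chain of `len` strict dominance steps of partitions of `N`
starting (on top) at `a`. -/
def partChain (a : ℕ → ℕ) (N len : ℕ) : Prop :=
  ∃ c : ℕ → ℕ → ℕ, (∀ i ≤ len, IsPartitionOf (c i) N) ∧ c len = a ∧
    ∀ i < len, Dominates (c (i + 1)) (c i) ∧ c (i + 1) ≠ c i

/-- The structure `T_α^M ∈ A_{m+1}`. -/
def Tstr {m : ℕ} (α : k) (M : Matrix (Fin m) (Fin m) k) : AlgStr k (m + 1) :=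
  ofConst fun i j mm =>
    if hi : i = 0 then
      if hj : j = 0 then (if mm = 0 then α else 0)
      else if hmm : mm = 0 then 0 else M (mm.pred hmm) (j.pred hj)
    else if hj : j = 0 then
      if hmm : mm = 0 then 0 else (if i = mm then α else 0) - M (mm.pred hmm) (i.pred hi)
    else 0

/-- The trivial singular extension `k^{n-2} ⋊_{(L₁,R₁,L₂,R₂)} χ` of the
`2`-dimensional algebra `χ` given by the coefficients `c11, c12, c21, d12, d21, d22`
(with `χ(e₁,e₁) = c11·e₁ + e₂`, `χ(e₁,e₂) = c12·e₁ + d12·e₂`,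
`χ(e₂,e₁) = c21·e₁ + d21·e₂`, `χ(e₂,e₂) = d22·e₂`). -/
def sdExt {m : ℕ} (c11 c12 c21 d12 d21 d22 : k)
    (L1 R1 L2 R2 : Matrix (Fin m) (Fin m) k) : AlgStr k (m + 2) :=
  ofConst fun i j mm =>
    if hi0 : (i : ℕ) = 0 then
      if hj0 : (j : ℕ) = 0 then
        if (mm : ℕ) = 0 then c11 else if (mm : ℕ) = 1 then 1 else 0
      else if hj1 : (j : ℕ) = 1 then
        if (mm : ℕ) = 0 then c12 else if (mm : ℕ) = 1 then d12 else 0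
      else if hmm : (mm : ℕ) < 2 then 0
      else L1 ⟨(mm : ℕ) - 2, by have := mm.isLt; omega⟩
             ⟨(j : ℕ) - 2, by have := j.isLt; omega⟩
    else if hi1 : (i : ℕ) = 1 then
      if hj0 : (j : ℕ) = 0 then
        if (mm : ℕ) = 0 then c21 else if (mm : ℕ) = 1 then d21 else 0
      else if hj1 : (j : ℕ) = 1 then
        if (mm : ℕ) = 1 then d22 else 0
      else if hmm : (mm : ℕ) < 2 then 0
      else L2 ⟨(mm : ℕ) - 2, by have := mm.isLt; omega⟩
             ⟨(j : ℕ) - 2, by have := j.isLt; omega⟩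
    else
      if hj0 : (j : ℕ) = 0 then
        if hmm : (mm : ℕ) < 2 then 0
        else R1 ⟨(mm : ℕ) - 2, by have := mm.isLt; omega⟩
               ⟨(i : ℕ) - 2, by have := i.isLt; omega⟩
      else if hj1 : (j : ℕ) = 1 then
        if hmm : (mm : ℕ) < 2 then 0
        else R2 ⟨(mm : ℕ) - 2, by have := mm.isLt; omega⟩
               ⟨(i : ℕ) - 2, by have := i.isLt; omega⟩
      else 0

/-! Concrete algebra structures, given by multiplication tables on the standard
basis `e₁, …, eₙ` (0-indexed as `0, …, n-1`); all unspecified products are zero. -/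

/-- `A₃ ⊕ k^{n-2}`: `e₁e₁ = e₂`. -/
def A3str (n : ℕ) : AlgStr k n :=
  ofConst fun i j m => if (i : ℕ) = 0 ∧ (j : ℕ) = 0 ∧ (m : ℕ) = 1 then 1 else 0

/-- `n₃ ⊕ k^{n-3}`: `e₁e₂ = e₃`, `e₂e₁ = -e₃`. -/
def n3str (n : ℕ) : AlgStr k n :=
  ofConst fun i j m =>
    if (i : ℕ) = 0 ∧ (j : ℕ) = 1 ∧ (m : ℕ) = 2 then 1
    else if (i : ℕ) = 1 ∧ (j : ℕ) = 0 ∧ (m : ℕ) = 2 then -1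
    else 0

/-- `p⁻`: `e₁eᵢ = eᵢ`, `eᵢe₁ = -eᵢ` for `i ≥ 2`. -/
def pminusStr (n : ℕ) : AlgStr k n :=
  ofConst fun i j m =>
    if (i : ℕ) = 0 ∧ 1 ≤ (j : ℕ) ∧ m = j then 1
    else if 1 ≤ (i : ℕ) ∧ (j : ℕ) = 0 ∧ m = i then -1
    else 0

/-- `ν^α`: `e₁e₁ = e₁`, `e₁eᵢ = α eᵢ`, `eᵢe₁ = (1-α) eᵢ` for `i ≥ 2`. -/
def nuStr (n : ℕ) (α : k) : AlgStr k n :=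
  ofConst fun i j m =>
    if (i : ℕ) = 0 then
      if (j : ℕ) = 0 then (if (m : ℕ) = 0 then 1 else 0)
      else (if m = j then α else 0)
    else if (j : ℕ) = 0 then (if m = i then 1 - α else 0)
    else 0

/-- `k^{n-2} ⋊ E₄`: `e₁e₁ = e₁`, `e₁e₂ = e₁ + e₂`, `e₂e₂ = e₂`,
`e₁eᵢ = eᵢ`, `eᵢe₂ = eᵢ` for `i ≥ 3`.  (For `n = 2` this is `E₄`.) -/
def kE4str (n : ℕ) : AlgStr k n :=
  ofConst fun i j m =>
    if (i : ℕ) = 0 ∧ (j : ℕ) = 0 then (if (m : ℕ) = 0 then 1 else 0)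
    else if (i : ℕ) = 0 ∧ (j : ℕ) = 1 then (if (m : ℕ) = 0 ∨ (m : ℕ) = 1 then 1 else 0)
    else if (i : ℕ) = 1 ∧ (j : ℕ) = 1 then (if (m : ℕ) = 1 then 1 else 0)
    else if (i : ℕ) = 0 ∧ 2 ≤ (j : ℕ) then (if m = j then 1 else 0)
    else if 2 ≤ (i : ℕ) ∧ (j : ℕ) = 1 then (if m = i then 1 else 0)
    else 0

/-- `T₀^{2,(α,β)}`: `e₁e₂ = αe₂ + e₃`, `e₂e₁ = -αe₂ - e₃`,
`e₁eᵢ = βeᵢ`, `eᵢe₁ = -βeᵢ` for `i ≥ 3`. -/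
def T02str (n : ℕ) (α β : k) : AlgStr k n :=
  ofConst fun i j m =>
    if (i : ℕ) = 0 ∧ (j : ℕ) = 1 then
      (if (m : ℕ) = 1 then α else if (m : ℕ) = 2 then 1 else 0)
    else if (i : ℕ) = 1 ∧ (j : ℕ) = 0 then
      (if (m : ℕ) = 1 then -α else if (m : ℕ) = 2 then -1 else 0)
    else if (i : ℕ) = 0 ∧ 2 ≤ (j : ℕ) then (if m = j then β else 0)
    else if 2 ≤ (i : ℕ) ∧ (j : ℕ) = 0 then (if m = i then -β else 0)
    else 0

/-- `T₁^{2,(α,β)}`: `e₁e₁ = e₁`, `e₁e₂ = αe₂ + e₃`, `e₂e₁ = (1-α)e₂ - e₃`,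
`e₁eᵢ = βeᵢ`, `eᵢe₁ = (1-β)eᵢ` for `i ≥ 3`. -/
def T12str (n : ℕ) (α β : k) : AlgStr k n :=
  ofConst fun i j m =>
    if (i : ℕ) = 0 ∧ (j : ℕ) = 0 then (if (m : ℕ) = 0 then 1 else 0)
    else if (i : ℕ) = 0 ∧ (j : ℕ) = 1 then
      (if (m : ℕ) = 1 then α else if (m : ℕ) = 2 then 1 else 0)
    else if (i : ℕ) = 1 ∧ (j : ℕ) = 0 then
      (if (m : ℕ) = 1 then 1 - α else if (m : ℕ) = 2 then -1 else 0)
    else if (i : ℕ) = 0 ∧ 2 ≤ (j : ℕ) then (if m = j then β else 0)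
    else if 2 ≤ (i : ℕ) ∧ (j : ℕ) = 0 then (if m = i then 1 - β else 0)
    else 0

/-- `T₀³`: `e₁e₂ = e₃`, `e₂e₁ = -e₃`, `e₁e₃ = e₄`, `e₃e₁ = -e₄`. -/
def T03str (n : ℕ) : AlgStr k n :=
  ofConst fun i j m =>
    if (i : ℕ) = 0 ∧ (j : ℕ) = 1 ∧ (m : ℕ) = 2 then 1
    else if (i : ℕ) = 1 ∧ (j : ℕ) = 0 ∧ (m : ℕ) = 2 then -1
    else if (i : ℕ) = 0 ∧ (j : ℕ) = 2 ∧ (m : ℕ) = 3 then 1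
    else if (i : ℕ) = 2 ∧ (j : ℕ) = 0 ∧ (m : ℕ) = 3 then -1
    else 0

/-- `T₀^{2,2}`: `e₁e₂ = e₃`, `e₂e₁ = -e₃`, `e₁e₄ = e₅`, `e₄e₁ = -e₅`. -/
def T022str (n : ℕ) : AlgStr k n :=
  ofConst fun i j m =>
    if (i : ℕ) = 0 ∧ (j : ℕ) = 1 ∧ (m : ℕ) = 2 then 1
    else if (i : ℕ) = 1 ∧ (j : ℕ) = 0 ∧ (m : ℕ) = 2 then -1
    else if (i : ℕ) = 0 ∧ (j : ℕ) = 3 ∧ (m : ℕ) = 4 then 1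
    else if (i : ℕ) = 3 ∧ (j : ℕ) = 0 ∧ (m : ℕ) = 4 then -1
    else 0

/-- `η_l ⊕ k^{n-2l-1}`: `e_{2i-1}e_{2i} = e_{2l+1}`, `e_{2i}e_{2i-1} = -e_{2l+1}`
for `1 ≤ i ≤ l`. -/
def etaStr (n l : ℕ) : AlgStr k n :=
  ofConst fun i j m =>
    if (i : ℕ) % 2 = 0 ∧ (j : ℕ) = (i : ℕ) + 1 ∧ (i : ℕ) < 2 * l ∧ (m : ℕ) = 2 * l then 1
    else if (j : ℕ) % 2 = 0 ∧ (i : ℕ) = (j : ℕ) + 1 ∧ (j : ℕ) < 2 * l ∧ (m : ℕ) = 2 * l then -1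
    else 0

/-- `F^{α,β} ⊕ k^{n-3}`: `e₁e₁ = e₃`, `e₁e₂ = αe₃`, `e₂e₁ = βe₃`. -/
def FabStr (n : ℕ) (α β : k) : AlgStr k n :=
  ofConst fun i j m =>
    if (i : ℕ) = 0 ∧ (j : ℕ) = 0 ∧ (m : ℕ) = 2 then 1
    else if (i : ℕ) = 0 ∧ (j : ℕ) = 1 ∧ (m : ℕ) = 2 then α
    else if (i : ℕ) = 1 ∧ (j : ℕ) = 0 ∧ (m : ℕ) = 2 then β
    else 0

/-- `k^{n-2} ⋊ A₃`: `e₁e₁ = e₂`, `e₁eᵢ = eᵢ`, `eᵢe₁ = -eᵢ` for `i ≥ 3`. -/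
def kA3str (n : ℕ) : AlgStr k n :=
  ofConst fun i j m =>
    if (i : ℕ) = 0 ∧ (j : ℕ) = 0 ∧ (m : ℕ) = 1 then 1
    else if (i : ℕ) = 0 ∧ 2 ≤ (j : ℕ) then (if m = j then 1 else 0)
    else if 2 ≤ (i : ℕ) ∧ (j : ℕ) = 0 then (if m = i then -1 else 0)
    else 0

/-- `k² ⋊_{α,β} A₃ ⊕ k^{n-4}`: `e₁e₁ = e₂`, `e₁e₃ = αe₄`, `e₃e₁ = βe₄`. -/
def k2A3str (n : ℕ) (α β : k) : AlgStr k n :=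
  ofConst fun i j m =>
    if (i : ℕ) = 0 ∧ (j : ℕ) = 0 ∧ (m : ℕ) = 1 then 1
    else if (i : ℕ) = 0 ∧ (j : ℕ) = 2 ∧ (m : ℕ) = 3 then α
    else if (i : ℕ) = 2 ∧ (j : ℕ) = 0 ∧ (m : ℕ) = 3 then β
    else 0

/-- `k^{n-2} ⋊_α A₁^α`: `e₁e₁ = e₁ + e₂`, `e₁eᵢ = αeᵢ`, `eᵢe₁ = (1-α)eᵢ` for `i ≥ 2`. -/
def kA1str (n : ℕ) (α : k) : AlgStr k n :=
  ofConst fun i j m =>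
    if (i : ℕ) = 0 ∧ (j : ℕ) = 0 then (if (m : ℕ) = 0 ∨ (m : ℕ) = 1 then 1 else 0)
    else if (i : ℕ) = 0 then (if m = j then α else 0)
    else if (j : ℕ) = 0 then (if m = i then 1 - α else 0)
    else 0

/-- `k^{n-2} ⋊₁ A₂`: `e₁e₁ = e₂`, `e₁eᵢ = eᵢ`, `eᵢe₁ = -eᵢ` for `i ≥ 2`. -/
def kA2str (n : ℕ) : AlgStr k n :=
  ofConst fun i j m =>
    if (i : ℕ) = 0 ∧ (j : ℕ) = 0 then (if (m : ℕ) = 1 then 1 else 0)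
    else if (i : ℕ) = 0 then (if m = j then 1 else 0)
    else if (j : ℕ) = 0 then (if m = i then -1 else 0)
    else 0

/-- `k^{n-2} ⋊₀ᵗ B₂^α`: `e₁eᵢ = αeᵢ`, `eᵢe₁ = (1-α)eᵢ` for `i ≥ 2`. -/
def ktB2str (n : ℕ) (α : k) : AlgStr k n :=
  ofConst fun i j m =>
    if (i : ℕ) = 0 ∧ 1 ≤ (j : ℕ) then (if m = j then α else 0)
    else if 1 ≤ (i : ℕ) ∧ (j : ℕ) = 0 then (if m = i then 1 - α else 0)
    else 0

/-- `k^{n-2} ⋊₀ᵗ D₂^{α,β}`: `e₁e₁ = e₁`, `e₁eᵢ = αeᵢ`, `eᵢe₁ = βeᵢ` for `i ≥ 2`. -/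
def ktD2str (n : ℕ) (α β : k) : AlgStr k n :=
  ofConst fun i j m =>
    if (i : ℕ) = 0 ∧ (j : ℕ) = 0 then (if (m : ℕ) = 0 then 1 else 0)
    else if (i : ℕ) = 0 then (if m = j then α else 0)
    else if (j : ℕ) = 0 then (if m = i then β else 0)
    else 0


theorem ofConst_apply {n : ℕ} (c : Fin n → Fin n → Fin n → k) (x y : Fin n → k) (l : Fin n) :
    ofConst c x y l = ∑ i, ∑ j, x i * y j * c i j l := by
  simp [ofConst, LinearMap.sum_apply, Finset.sum_apply]

/-- The product of `sdExt` in block form: vectors are written as `x e₁ + y e₂ + v`. -/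
theorem sdExt_vecCons {m : ℕ} (c11 c12 c21 d12 d21 d22 : k)
    (L1 R1 L2 R2 : Matrix (Fin m) (Fin m) k) (x y x' y' : k) (v v' : Fin m → k) :
    sdExt c11 c12 c21 d12 d21 d22 L1 R1 L2 R2
        (Matrix.vecCons x (Matrix.vecCons y v)) (Matrix.vecCons x' (Matrix.vecCons y' v')) =
      Matrix.vecCons (c11 * (x * x') + c12 * (x * y') + c21 * (y * x'))
        (Matrix.vecCons (x * x' + d12 * (x * y') + d21 * (y * x') + d22 * (y * y'))
          (x • L1.mulVec v' + y • L2.mulVec v' + x' • R1.mulVec v + y' • R2.mulVec v)) := by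
  funext l
  rw [sdExt, ofConst_apply]
  simp only [Fin.sum_univ_succ, Matrix.cons_val_zero, Matrix.cons_val_succ]
  refine Fin.cases ?_ (fun l => Fin.cases ?_ (fun l => ?_) l) l
  · simp
    ring
  · simp
    ring
  · simp [Matrix.mulVec, dotProduct, Finset.mul_sum]
    simp only [Finset.sum_add_distrib, mul_comm, mul_left_comm]
    abel

theorem subset_subalgGen {n : ℕ} (μ : AlgStr k n) (s : Set (Fin n → k)) :
    s ⊆ subalgGen μ s := fun _ hx =>
  Submodule.mem_sInf.2 fun _ hW => hW.1 hx

theorem mul_mem_subalgGen {n : ℕ} (μ : AlgStr k n) (s : Set (Fin n → k)) {x y : Fin n → k}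
    (hx : x ∈ subalgGen μ s) (hy : y ∈ subalgGen μ s) : μ x y ∈ subalgGen μ s :=
  Submodule.mem_sInf.2 fun W hW =>
    hW.2 x (Submodule.mem_sInf.1 hx W hW) y (Submodule.mem_sInf.1 hy W hW)

theorem finrank_span_pair_le {n : ℕ} (b c : Fin n → k) :
    Module.finrank k (Submodule.span k {b, c}) ≤ 2 := by
  classical
  have h := finrank_span_finset_le_card (R := k) ({b, c} : Finset (Fin n → k))
  rw [Finset.coe_pair] at h
  exact h.trans Finset.card_le_two

theorem finrank_subalgGen_le_two {n : ℕ} (μ : AlgStr k n) {a b c : Fin n → k}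
    (ha : a ∈ Submodule.span k {b, c})
    (hbb : μ b b ∈ Submodule.span k {b, c}) (hbc : μ b c ∈ Submodule.span k {b, c})
    (hcb : μ c b ∈ Submodule.span k {b, c}) (hcc : μ c c ∈ Submodule.span k {b, c}) :
    Module.finrank k (subalgGen μ {a}) ≤ 2 := by
  have hle : subalgGen μ {a} ≤ Submodule.span k {b, c} := by
    refine sInf_le ⟨Set.singleton_subset_iff.2 ha, ?_⟩
    intro x hx y hy
    obtain ⟨p, q, rfl⟩ := Submodule.mem_span_pair.1 hx
    obtain ⟨r, s, rfl⟩ := Submodule.mem_span_pair.1 hy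
    simp only [map_add, map_smul, LinearMap.add_apply, LinearMap.smul_apply]
    exact add_mem
      (Submodule.smul_mem _ _ (add_mem (Submodule.smul_mem _ _ hbb) (Submodule.smul_mem _ _ hcb)))
      (Submodule.smul_mem _ _ (add_mem (Submodule.smul_mem _ _ hbc) (Submodule.smul_mem _ _ hcc)))
  exact (Submodule.finrank_mono hle).trans (finrank_span_pair_le b c)

theorem linearIndependent_vecCons_pair {m : ℕ} (v w : Fin m → k) :
    LinearIndependent k ![Matrix.vecCons (1 : k) (Matrix.vecCons 0 v),
      Matrix.vecCons 0 (Matrix.vecCons 1 w)] := by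
  refine LinearIndependent.pair_iff.2 fun s t h => ?_
  exact ⟨by simpa using congrFun h 0, by simpa using congrFun h 1⟩

theorem finrank_span_vecCons_pair {m : ℕ} (v w : Fin m → k) :
    Module.finrank k (Submodule.span k {Matrix.vecCons (1 : k) (Matrix.vecCons 0 v),
      Matrix.vecCons 0 (Matrix.vecCons 1 w)}) = 2 := by
  have h := finrank_span_eq_card (linearIndependent_vecCons_pair v w)
  rwa [Matrix.range_cons, Matrix.range_cons, Matrix.range_empty, Set.union_empty,
    Set.singleton_union, Fintype.card_fin] at h

/-- If `e₁ + v` generates a subalgebra of dimension at most two, then it is spanned by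
`e₁ + v` and `e₂ + (L₁ + R₁ - c₁₁) v`. -/
theorem subalgGen_sdExt_eq_span {m : ℕ} {c11 c12 c21 d12 d21 d22 : k}
    {L1 R1 L2 R2 S : Matrix (Fin m) (Fin m) k}
    (hR : ∀ v, R1.mulVec v = S.mulVec v + c11 • v - L1.mulVec v) (v : Fin m → k)
    (h : Module.finrank k (subalgGen (sdExt c11 c12 c21 d12 d21 d22 L1 R1 L2 R2)
      {Matrix.vecCons 1 (Matrix.vecCons 0 v)}) ≤ 2) :
    Submodule.span k {Matrix.vecCons 1 (Matrix.vecCons 0 v),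
        Matrix.vecCons 0 (Matrix.vecCons 1 (S.mulVec v))} =
      subalgGen (sdExt c11 c12 c21 d12 d21 d22 L1 R1 L2 R2)
        {Matrix.vecCons 1 (Matrix.vecCons 0 v)} := by
  have ha : Matrix.vecCons 1 (Matrix.vecCons 0 v) ∈ subalgGen (sdExt c11 c12 c21 d12 d21 d22 L1 R1 L2 R2)
      {Matrix.vecCons 1 (Matrix.vecCons 0 v)} := subset_subalgGen _ _ rfl
  refine Submodule.eq_of_le_of_finrank_le (Submodule.span_le.2 ?_) (h.trans ?_)
  · rintro _ (rfl | rfl)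
    · exact ha
    · have h2 := sub_mem (mul_mem_subalgGen _ _ ha ha) (Submodule.smul_mem _ c11 ha)
      rw [sdExt_vecCons, hR] at h2
      simp only [Matrix.smul_cons, Matrix.cons_sub_cons, smul_eq_mul] at h2
      rw [SetLike.mem_coe]
      convert h2 using 3
      · ring
      · ring
      · module
  · exact (finrank_span_vecCons_pair v (S.mulVec v)).ge

theorem vecCons_eq_smul_add_smul {m : ℕ} {x y : k} {v w u : Fin m → k}
    (h : Matrix.vecCons x (Matrix.vecCons y u) ∈
      Submodule.span k {Matrix.vecCons 1 (Matrix.vecCons 0 v),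
        Matrix.vecCons 0 (Matrix.vecCons 1 w)}) : u = x • v + y • w := by
  obtain ⟨p, q, h⟩ := Submodule.mem_span_pair.1 h
  have hx : p = x := by simpa using congrFun h 0
  have hy : q = y := by simpa using congrFun h 1
  subst hx hy
  funext i
  simpa using (congrFun h i.succ.succ).symm

theorem smul_add_smul_mem_span {m : ℕ} (x y : k) (v w : Fin m → k) :
    Matrix.vecCons x (Matrix.vecCons y (x • v + y • w)) ∈
      Submodule.span k {Matrix.vecCons 1 (Matrix.vecCons 0 v),
        Matrix.vecCons 0 (Matrix.vecCons 1 w)} :=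
  Submodule.mem_span_pair.2 ⟨x, y, by simp [Matrix.smul_cons]⟩

theorem eq_iff_forall_mulVec_eq {m : ℕ} (A B : Matrix (Fin m) (Fin m) k) :
    A = B ↔ ∀ v, A.mulVec v = B.mulVec v :=
  ⟨fun h _ => h ▸ rfl, fun h => Matrix.toLin'.injective (LinearMap.ext h)⟩

section

variable {m : ℕ} {c11 c12 c21 d12 d21 d22 : k} {L1 R1 L2 R2 S : Matrix (Fin m) (Fin m) k}

theorem mulVec_eq_of_finrank_subalgGen_le_two
    (hR : ∀ v, R1.mulVec v = S.mulVec v + c11 • v - L1.mulVec v)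
    (h : ∀ a, Module.finrank k
      (subalgGen (sdExt c11 c12 c21 d12 d21 d22 L1 R1 L2 R2) {a}) ≤ 2) (v : Fin m → k) :
    L2.mulVec v = d21 • S.mulVec v - R1.mulVec (S.mulVec v) + c21 • v ∧
      R2.mulVec v = d12 • S.mulVec v - L1.mulVec (S.mulVec v) + c12 • v ∧
      L2.mulVec (S.mulVec v) + R2.mulVec (S.mulVec v) = d22 • S.mulVec v := by
  have hs := subalgGen_sdExt_eq_span hR v (h _)
  have ha : Matrix.vecCons 1 (Matrix.vecCons 0 v) ∈
      Submodule.span k {Matrix.vecCons 1 (Matrix.vecCons 0 v),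
        Matrix.vecCons 0 (Matrix.vecCons 1 (S.mulVec v))} := Submodule.subset_span (by simp)
  have hb : Matrix.vecCons 0 (Matrix.vecCons 1 (S.mulVec v)) ∈
      Submodule.span k {Matrix.vecCons 1 (Matrix.vecCons 0 v),
        Matrix.vecCons 0 (Matrix.vecCons 1 (S.mulVec v))} := Submodule.subset_span (by simp)
  rw [hs] at ha hb
  have hab := mul_mem_subalgGen _ _ ha hb
  have hba := mul_mem_subalgGen _ _ hb ha
  have hbb := mul_mem_subalgGen _ _ hb hb
  rw [← hs, sdExt_vecCons] at hab hba hbb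
  have hab := vecCons_eq_smul_add_smul hab
  have hba := vecCons_eq_smul_add_smul hba
  have hbb := vecCons_eq_smul_add_smul hbb
  refine ⟨?_, ?_, ?_⟩
  · linear_combination (norm := module) hba
  · linear_combination (norm := module) hab
  · linear_combination (norm := module) hbb

/-- `e₁ + u` and `e₂ + S u` span a subalgebra. -/
theorem finrank_subalgGen_le_two_of_eq
    (hR : ∀ v, R1.mulVec v = S.mulVec v + c11 • v - L1.mulVec v)
    (hL2 : ∀ v, L2.mulVec v = d21 • S.mulVec v - R1.mulVec (S.mulVec v) + c21 • v)
    (hR2 : ∀ v, R2.mulVec v = d12 • S.mulVec v - L1.mulVec (S.mulVec v) + c12 • v)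
    (hS : ∀ v, L2.mulVec (S.mulVec v) + R2.mulVec (S.mulVec v) = d22 • S.mulVec v)
    (x y : k) (u : Fin m → k) :
    Module.finrank k (subalgGen (sdExt c11 c12 c21 d12 d21 d22 L1 R1 L2 R2)
      {Matrix.vecCons x (Matrix.vecCons y (x • u + y • S.mulVec u))}) ≤ 2 := by
  refine finrank_subalgGen_le_two _ (smul_add_smul_mem_span x y u (S.mulVec u)) ?_ ?_ ?_ ?_ <;>
    rw [sdExt_vecCons] <;>
    convert smul_add_smul_mem_span _ _ u (S.mulVec u) using 3
  · linear_combination (norm := module) hR u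
  · linear_combination (norm := module) hR2 u
  · linear_combination (norm := module) hL2 u
  · linear_combination (norm := module) hS u

/-- An element `a` with `a² = α a + w`, where `w` is a common eigenvector of the
multiplications by `a` and lies in the square-zero ideal. -/
theorem finrank_subalgGen_le_two_of_eigenvector {x y α l r : k} {v w : Fin m → k}
    (h0 : c11 * (x * x) + c12 * (x * y) + c21 * (y * x) = α * x)
    (h1 : x * x + d12 * (x * y) + d21 * (y * x) + d22 * (y * y) = α * y)
    (h2 : x • L1.mulVec v + y • L2.mulVec v + x • R1.mulVec v + y • R2.mulVec v = α • v + w)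
    (hl : x • L1.mulVec w + y • L2.mulVec w = l • w)
    (hr : x • R1.mulVec w + y • R2.mulVec w = r • w) :
    Module.finrank k (subalgGen (sdExt c11 c12 c21 d12 d21 d22 L1 R1 L2 R2)
      {Matrix.vecCons x (Matrix.vecCons y v)}) ≤ 2 := by
  refine finrank_subalgGen_le_two _ (c := Matrix.vecCons 0 (Matrix.vecCons 0 w))
    (Submodule.subset_span (Set.mem_insert _ _)) ?_ ?_ ?_ ?_ <;>
    rw [sdExt_vecCons, Submodule.mem_span_pair]
  · exact ⟨α, 1, by simp [Matrix.smul_cons, h0, h1, h2]⟩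
  · exact ⟨0, l, by simp [Matrix.smul_cons, hl]⟩
  · exact ⟨0, r, by simp [Matrix.smul_cons, hr]⟩
  · exact ⟨0, 0, by simp⟩

theorem finrank_subalgGen_sdExt_le_two
    (hR : ∀ v, R1.mulVec v = S.mulVec v + c11 • v - L1.mulVec v)
    (hL2 : ∀ v, L2.mulVec v = d21 • S.mulVec v - R1.mulVec (S.mulVec v) + c21 • v)
    (hR2 : ∀ v, R2.mulVec v = d12 • S.mulVec v - L1.mulVec (S.mulVec v) + c12 • v)
    (hS : ∀ v, L2.mulVec (S.mulVec v) + R2.mulVec (S.mulVec v) = d22 • S.mulVec v)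
    (x y : k) (v : Fin m → k) :
    Module.finrank k (subalgGen (sdExt c11 c12 c21 d12 d21 d22 L1 R1 L2 R2)
      {Matrix.vecCons x (Matrix.vecCons y v)}) ≤ 2 := by
  have hS3 : ∀ v, S.mulVec (S.mulVec (S.mulVec v)) = (d12 + d21 - c11) • S.mulVec (S.mulVec v) +
      (c12 + c21 - d22) • S.mulVec v := fun v => by
    linear_combination (norm := module) hL2 (S.mulVec v) + hR2 (S.mulVec v) - hS v -
      hR (S.mulVec (S.mulVec v))
  by_cases hx : x = 0
  · subst hx
    have hw : S.mulVec (L2.mulVec v + R2.mulVec v - d22 • v) = 0 := by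
      have : L2.mulVec v + R2.mulVec v - d22 • v = (d12 + d21 - c11) • S.mulVec v -
          S.mulVec (S.mulVec v) + (c12 + c21 - d22) • v := by
        linear_combination (norm := module) hL2 v + hR2 v - hR (S.mulVec v)
      rw [this]
      simp only [Matrix.mulVec_add, Matrix.mulVec_sub, Matrix.mulVec_smul]
      linear_combination (norm := module) - hS3 v
    refine finrank_subalgGen_le_two_of_eigenvector (α := d22 * y) (l := y * c21) (r := y * c12)
      (w := y • (L2.mulVec v + R2.mulVec v - d22 • v)) (by ring) (by ring) (by module) ?_ ?_
    · simp [Matrix.mulVec_smul, hL2 (L2.mulVec v + R2.mulVec v - d22 • v), hw, smul_smul]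
      module
    · simp [Matrix.mulVec_smul, hR2 (L2.mulVec v + R2.mulVec v - d22 • v), hw, smul_smul]
      module
  · obtain ⟨t, rfl⟩ : ∃ t, y = x * t := ⟨y / x, by field_simp⟩
    by_cases hb : 1 + t * (d12 + d21 - c11) + t ^ 2 * (d22 - c12 - c21) = 0
    · set w := (1 + t * (d12 + d21 - c11)) • S.mulVec v - t • S.mulVec (S.mulVec v) with hwdef
      have hw : w + t • S.mulVec w = 0 := by
        rw [hwdef]
        simp only [Matrix.mulVec_sub, Matrix.mulVec_smul]
        linear_combination (norm := module) (- t ^ 2) • hS3 v + hb • S.mulVec v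
      have hL : L1.mulVec w + t • L1.mulVec (S.mulVec w) = 0 := by
        rw [← Matrix.mulVec_smul, ← Matrix.mulVec_add, hw, Matrix.mulVec_zero]
      have hR' : R1.mulVec w + t • R1.mulVec (S.mulVec w) = 0 := by
        rw [← Matrix.mulVec_smul, ← Matrix.mulVec_add, hw, Matrix.mulVec_zero]
      have ht : t ≠ 0 := by
        rintro rfl
        simp at hb
      have hSw : S.mulVec w = (-t⁻¹) • w := by
        have hc : -t⁻¹ * t + 1 = 0 := by field_simp; ring
        linear_combination (norm := module) t⁻¹ • hw + hc • S.mulVec w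
      refine finrank_subalgGen_le_two_of_eigenvector
        (α := x * (c11 + t * (c12 + c21))) (l := x * (-t⁻¹ + c11 - d21 + t * c21))
        (r := x * (-t⁻¹ + c11 - d12 + t * c12)) (w := x • w) (by ring) ?_ ?_ ?_ ?_
      · linear_combination x ^ 2 * hb
      · rw [hwdef]
        linear_combination (norm := module)
          x • hR v + (x * t) • (hL2 v + hR2 v - hR (S.mulVec v))
      · simp only [Matrix.mulVec_smul]
        linear_combination (norm := module)
          (x * x) • (hR w + t • hL2 w - hR' + hSw + d21 • hw)
      · simp only [Matrix.mulVec_smul]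
        linear_combination (norm := module)
          (x * x) • (hR w + t • hR2 w - hL + hSw + d12 • hw)
    · set β := 1 + t * (d12 + d21 - c11) + t ^ 2 * (d22 - c12 - c21) with hβ
      set w := (1 + t * (d12 + d21 - c11)) • S.mulVec v - t • S.mulVec (S.mulVec v) with hwdef
      have hSu : S.mulVec (x⁻¹ • (v - (t * β⁻¹) • w)) = (x⁻¹ * β⁻¹) • w := by
        have hc : β⁻¹ * (1 + t * (d12 + d21 - c11) + t ^ 2 * (d22 - c12 - c21)) - 1 = 0 := by
          rw [← hβ, inv_mul_cancel₀ hb, sub_self]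
        rw [hwdef]
        simp only [Matrix.mulVec_sub, Matrix.mulVec_smul]
        linear_combination (norm := module)
          (x⁻¹ * t ^ 2 * β⁻¹) • hS3 v - (x⁻¹ • hc) • S.mulVec v
      have hv : v = x • x⁻¹ • (v - (t * β⁻¹) • w) +
          (x * t) • S.mulVec (x⁻¹ • (v - (t * β⁻¹) • w)) := by
        rw [hSu, smul_inv_smul₀ hx, smul_smul]
        have hc : x * t * (x⁻¹ * β⁻¹) = t * β⁻¹ := by field_simp
        rw [hc, sub_add_cancel]
      rw [hv]
      exact finrank_subalgGen_le_two_of_eq hR hL2 hR2 hS x (x * t) _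

theorem genType_sdExt_two_iff
    (hR : ∀ v, R1.mulVec v = S.mulVec v + c11 • v - L1.mulVec v) :
    genType (sdExt c11 c12 c21 d12 d21 d22 L1 R1 L2 R2) 2 ↔
      (∀ v, L2.mulVec v = d21 • S.mulVec v - R1.mulVec (S.mulVec v) + c21 • v) ∧
      (∀ v, R2.mulVec v = d12 • S.mulVec v - L1.mulVec (S.mulVec v) + c12 • v) ∧
      ∀ v, L2.mulVec (S.mulVec v) + R2.mulVec (S.mulVec v) = d22 • S.mulVec v := by
  constructor
  · intro h
    have key := mulVec_eq_of_finrank_subalgGen_le_two hR fun a => h.2 ⟨a, rfl⟩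
    exact ⟨fun v => (key v).1, fun v => (key v).2.1, fun v => (key v).2.2⟩
  · rintro ⟨hL2, hR2, hS⟩
    have hle : ∀ a, Module.finrank k
        (subalgGen (sdExt c11 c12 c21 d12 d21 d22 L1 R1 L2 R2) {a}) ≤ 2 := fun a => by
      rw [← Matrix.cons_head_tail a, ← Matrix.cons_head_tail (Matrix.vecTail a)]
      exact finrank_subalgGen_sdExt_le_two hR hL2 hR2 hS _ _ _
    refine ⟨⟨Matrix.vecCons 1 (Matrix.vecCons 0 0), ?_⟩, ?_⟩
    · rw [← subalgGen_sdExt_eq_span hR 0 (hle _)]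
      exact finrank_span_vecCons_pair 0 _
    · rintro _ ⟨a, rfl⟩
      exact hle a

end

/-! ## STATEMENT 14 -/
theorem stmt14 {k : Type*} [Field k] [IsAlgClosed k] (m : ℕ) (hm : 1 ≤ m)
    (c11 c12 c21 d12 d21 d22 : k) (hd : d22 = 0 ∨ d22 = 1)
    (L1 R1 L2 R2 : Matrix (Fin m) (Fin m) k) :
    genType (sdExt c11 c12 c21 d12 d21 d22 L1 R1 L2 R2) 2 ↔
      (L2 = (d21 • (1 : Matrix (Fin m) (Fin m) k) - R1) *
              (L1 + R1 - c11 • (1 : Matrix (Fin m) (Fin m) k)) + c21 • 1 ∧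
       R2 = (d12 • (1 : Matrix (Fin m) (Fin m) k) - L1) *
              (L1 + R1 - c11 • (1 : Matrix (Fin m) (Fin m) k)) + c12 • 1 ∧
       (L1 + R1 - c11 • (1 : Matrix (Fin m) (Fin m) k)) ^ 3 +
          (c11 - d12 - d21) • (L1 + R1 - c11 • (1 : Matrix (Fin m) (Fin m) k)) ^ 2 +
          (d22 - c12 - c21) • (L1 + R1 - c11 • (1 : Matrix (Fin m) (Fin m) k)) = 0) := by
  set S := L1 + R1 - c11 • (1 : Matrix (Fin m) (Fin m) k) with hSdef
  have hR : ∀ v, R1.mulVec v = S.mulVec v + c11 • v - L1.mulVec v := fun v => by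
    rw [hSdef]
    simp only [Matrix.add_mulVec, Matrix.sub_mulVec, Matrix.smul_mulVec, Matrix.one_mulVec]
    abel
  rw [genType_sdExt_two_iff hR]
  simp only [eq_iff_forall_mulVec_eq, Matrix.add_mulVec, Matrix.sub_mulVec, Matrix.smul_mulVec,
    Matrix.one_mulVec, Matrix.zero_mulVec, ← Matrix.mulVec_mulVec, pow_succ, pow_zero, one_mul]
  refine and_congr_right fun hL2 => and_congr_right fun hR2 => forall_congr' fun v => ?_
  constructor <;> intro h
  · linear_combination (norm := module)
      hL2 (S.mulVec v) + hR2 (S.mulVec v) - h - hR (S.mulVec (S.mulVec v))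
  · linear_combination (norm := module)
      hL2 (S.mulVec v) + hR2 (S.mulVec v) - h - hR (S.mulVec (S.mulVec v))


end
end

section
/- Let A be an n-dimensional algebra that is a trivial singular extension of the 2-dimensional algebra A_3 (with basis f_1,f_2 and multiplication f_1f_1 = f_2, other products zero), i.e., A has an ideal I with I·I = 0 and a 2-dimensional subalgebra B_0 isomorphic to A_3 such that A = B_0 ⊕ I as a vector space. If G(A) = 2, then lev(A) ≠ 2. -/
open scoped BigOperators

noncomputable section

variable {k : Type*} [Field k]

section Degeneration

variable {n : ℕ}

@[simp] theorem transport_apply (g : (Fin n → k) ≃ₗ[k] (Fin n → k)) (μ : AlgStr k n)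
    (x y : Fin n → k) : transport g μ x y = g (μ (g.symm x) (g.symm y)) := rfl

/-- A polynomial relation satisfied on a set of structures extends to its Zariski closure. -/
theorem eval_eq_zero_of_mem_zclosure {S : Set (AlgStr k n)} {χ : AlgStr k n}
    (hχ : χ ∈ zclosure S) (p : MvPolynomial (Fin n × Fin n × Fin n) k)
    (hp : ∀ ν ∈ S, MvPolynomial.eval (structConst ν) p = 0) :
    MvPolynomial.eval (structConst χ) p = 0 :=
  hχ {ν | MvPolynomial.eval (structConst ν) p = 0} ⟨{p}, fun ν => by simp⟩ hp

theorem algStr_ext_structConst {μ χ : AlgStr k n} (h : ∀ t, structConst μ t = structConst χ t) :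
    μ = χ := by
  refine (Pi.basisFun k (Fin n)).ext fun i => (Pi.basisFun k (Fin n)).ext fun j => ?_
  funext m
  simpa [structConst] using h (i, j, m)

theorem eq_zero_of_structConst {χ : AlgStr k n} (h : ∀ t, structConst χ t = 0) : χ = 0 :=
  algStr_ext_structConst fun t => by rw [h t]; simp [structConst]

/-- If `μ` can be moved, for every `t ≠ 0`, to a structure of the form `χ + t ν₁ + t² ν₂`,
then `μ` degenerates to `χ`. Here `h t` plays the role of the inverse of the base change. -/
theorem degenerates_of_curve [Infinite k] (μ χ : AlgStr k n)
    (ν₁ ν₂ : (Fin n → k) → (Fin n → k) → (Fin n → k))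
    (h : k → (Fin n → k) →ₗ[k] (Fin n → k))
    (hinj : ∀ t, t ≠ 0 → ∀ x, h t x = 0 → x = 0)
    (hmul : ∀ t, t ≠ 0 → ∀ x y,
      μ (h t x) (h t y) = h t (χ x y + t • ν₁ x y + t ^ 2 • ν₂ x y)) :
    degenerates μ χ := by
  rintro T ⟨P, hP⟩ hT
  rw [hP]
  intro p hp
  let c : (Fin n × Fin n × Fin n) → Polynomial k := fun s =>
    Polynomial.C (structConst χ s)
      + Polynomial.X * Polynomial.C (ν₁ (Pi.single s.1 1) (Pi.single s.2.1 1) s.2.2)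
      + Polynomial.X ^ 2 * Polynomial.C (ν₂ (Pi.single s.1 1) (Pi.single s.2.1 1) s.2.2)
  let q : Polynomial k := MvPolynomial.eval₂ Polynomial.C c p
  have hq : ∀ t, q.eval t = MvPolynomial.eval (fun s => (c s).eval t) p := by
    intro t
    have := MvPolynomial.eval₂_comp_left (Polynomial.evalRingHom t) Polynomial.C c p
    simp only [Polynomial.coe_evalRingHom] at this
    rw [show q.eval t = _ from this, MvPolynomial.eval, MvPolynomial.coe_eval₂Hom]
    congr 1
    ext a
    simp
  have hq0 : q = 0 := by
    refine Polynomial.eq_zero_of_infinite_isRoot _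
      (Set.Infinite.mono (s := {t : k | t ≠ 0}) (fun t ht => ?_)
        (Set.finite_singleton (0 : k)).infinite_compl)
    have hinj' : Function.Injective (h t) := (injective_iff_map_eq_zero _).2 (hinj t ht)
    let g := LinearEquiv.ofInjectiveEndo (h t) hinj'
    have hmem : transport g.symm μ ∈ T := hT ⟨g.symm, rfl⟩
    have h0 := (hP _).1 hmem p hp
    rw [Set.mem_ofPred_eq, Polynomial.IsRoot, hq, ← h0]
    congr 2
    funext s
    have hg : ∀ x, g x = h t x := fun x => rfl
    simp only [structConst, transport_apply, LinearEquiv.symm_symm, hg]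
    rw [hmul t ht, ← hg, LinearEquiv.symm_apply_apply]
    simp [c, structConst]
    ring
  have h0 := hq 0
  rw [hq0, Polynomial.eval_zero] at h0
  rw [h0]
  congr 2
  funext s
  simp [c]

theorem degenerates_zero [Infinite k] (μ : AlgStr k n) : degenerates μ 0 := by
  refine degenerates_of_curve μ 0 (fun x y => μ x y) 0 (fun t => t • LinearMap.id) ?_ ?_
  · intro t ht x hx
    simpa [ht] using hx
  · intro t _ x y
    simp

theorem eq_zero_of_zero_mem_orbit {μ : AlgStr k n} (h : (0 : AlgStr k n) ∈ orbit μ) : μ = 0 := by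
  obtain ⟨g, hg⟩ := h
  refine LinearMap.ext₂ fun x y => ?_
  have := LinearMap.congr_fun₂ hg (g x) (g y)
  simpa using this

theorem eq_zero_of_degenerates_zero {χ : AlgStr k n} (h : degenerates (0 : AlgStr k n) χ) :
    χ = 0 := by
  refine eq_zero_of_structConst fun t => ?_
  have := eval_eq_zero_of_mem_zclosure h (MvPolynomial.X t) ?_
  · simpa using this
  · rintro _ ⟨g, rfl⟩
    simp [structConst]

/-- The structure `(x, y) ↦ B(x, y) b` attached to a bilinear form and a vector. -/
def formStr (B : (Fin n → k) →ₗ[k] (Fin n → k) →ₗ[k] k) (b : Fin n → k) : AlgStr k n :=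
  B.compr₂ (LinearMap.toSpanSingleton k _ b)

@[simp] theorem formStr_apply (B : (Fin n → k) →ₗ[k] (Fin n → k) →ₗ[k] k) (b x y : Fin n → k) :
    formStr B b x y = B x y • b := by
  simp [formStr]

/-- The structure `(x, y) ↦ φ(x) φ(y) b`; if `φ ≠ 0`, `b ≠ 0` and `φ(b) = 0` it is isomorphic to
`A₃ ⊕ kⁿ⁻²`. -/
def squareStr (φ : (Fin n → k) →ₗ[k] k) (b : Fin n → k) : AlgStr k n :=
  formStr (φ.smulRight φ) b

@[simp] theorem squareStr_apply (φ : (Fin n → k) →ₗ[k] k) (b x y : Fin n → k) :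
    squareStr φ b x y = (φ x * φ y) • b := by
  simp [squareStr]

theorem exists_linearEquiv_apply_eq {W : Type*} [AddCommGroup W] [Module k W]
    [FiniteDimensional k W] {x y : W} (hx : x ≠ 0) (hy : y ≠ 0) : ∃ g : W ≃ₗ[k] W, g x = y := by
  let f := (LinearEquiv.toSpanNonzeroSingleton k W x hx).symm ≪≫ₗ
    LinearEquiv.toSpanNonzeroSingleton k W y hy
  obtain ⟨g, hg⟩ := Submodule.exists_linearEquiv_restrict_eq f
  refine ⟨g, ?_⟩
  have := hg ⟨x, Submodule.mem_span_singleton_self x⟩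
  rw [← this]
  change ((LinearEquiv.toSpanNonzeroSingleton k W y hy)
    (LinearEquiv.coord k W x hx ⟨x, Submodule.mem_span_singleton_self x⟩) : W) = y
  rw [LinearEquiv.coord_self, LinearEquiv.toSpanNonzeroSingleton_one]

/-- `GL(V)` acts transitively on the pairs of a nonzero functional and a nonzero vector in its
kernel. -/
theorem exists_linearEquiv_dual_apply_eq {φ ψ : (Fin n → k) →ₗ[k] k} {b d : Fin n → k}
    (hφ : φ ≠ 0) (hψ : ψ ≠ 0) (hb : b ≠ 0) (hd : d ≠ 0) (hφb : φ b = 0) (hψd : ψ d = 0) :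
    ∃ g : (Fin n → k) ≃ₗ[k] (Fin n → k), (∀ x, ψ (g x) = φ x) ∧ g b = d := by
  obtain ⟨e, he⟩ : ∃ e, φ e = 1 := LinearMap.surjective hφ 1
  obtain ⟨f, hf⟩ : ∃ f, ψ f = 1 := LinearMap.surjective hψ 1
  have hrank : Module.finrank k (LinearMap.ker φ) = Module.finrank k (LinearMap.ker ψ) := by
    have h1 := Module.Dual.finrank_ker_add_one_of_ne_zero (f := φ) hφ
    have h2 := Module.Dual.finrank_ker_add_one_of_ne_zero (f := ψ) hψ
    omega
  let u := LinearEquiv.ofFinrankEq (LinearMap.ker φ) (LinearMap.ker ψ) hrank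
  obtain ⟨σ, hσ⟩ := exists_linearEquiv_apply_eq (k := k) (x := u ⟨b, hφb⟩)
    (y := (⟨d, hψd⟩ : LinearMap.ker ψ))
    (by simpa [← Subtype.coe_inj] using hb) (by simpa [← Subtype.coe_inj] using hd)
  let τ := u ≪≫ₗ σ
  let pr : (Fin n → k) →ₗ[k] LinearMap.ker φ :=
    (LinearMap.id - φ.smulRight e).codRestrict _ fun x => by simp [he]
  let g : (Fin n → k) →ₗ[k] (Fin n → k) :=
    (LinearMap.ker ψ).subtype ∘ₗ τ.toLinearMap ∘ₗ pr + φ.smulRight f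
  have hg : ∀ x, g x = τ (pr x) + φ x • f := fun x => rfl
  have hψg : ∀ x, ψ (g x) = φ x := fun x => by
    rw [hg, map_add, map_smul, hf, (τ (pr x)).2]; simp
  have hinj : Function.Injective g := by
    refine (injective_iff_map_eq_zero _).2 fun x hx => ?_
    have hφx : φ x = 0 := by rw [← hψg, hx, map_zero]
    rw [hg, hφx, zero_smul, add_zero] at hx
    have h2 : pr x = 0 := by simpa using hx
    have h3 : x - φ x • e = 0 := congrArg Subtype.val h2
    simpa [hφx] using h3
  refine ⟨LinearEquiv.ofInjectiveEndo g hinj, hψg, ?_⟩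
  have hprb : pr b = ⟨b, hφb⟩ := Subtype.ext (show b - φ b • e = b by simp [hφb])
  have : g b = d := by
    rw [hg, hprb, hφb, zero_smul, add_zero]
    simp [τ, hσ]
  exact this

theorem squareStr_mem_orbit {φ ψ : (Fin n → k) →ₗ[k] k} {b d : Fin n → k}
    (hφ : φ ≠ 0) (hψ : ψ ≠ 0) (hb : b ≠ 0) (hd : d ≠ 0) (hφb : φ b = 0) (hψd : ψ d = 0) :
    squareStr ψ d ∈ orbit (squareStr φ b) := by
  obtain ⟨g, hg, hgb⟩ := exists_linearEquiv_dual_apply_eq hφ hψ hb hd hφb hψd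
  refine ⟨g, LinearMap.ext₂ fun x y => ?_⟩
  simp [← hg, hgb]

theorem structConst_squareStr (φ : (Fin n → k) →ₗ[k] k) (b : Fin n → k) (i j m : Fin n) :
    structConst (squareStr φ b) (i, j, m) =
      φ (Pi.single i 1) * φ (Pi.single j 1) * b m := by
  simp [structConst]

theorem transport_squareStr (g : (Fin n → k) ≃ₗ[k] (Fin n → k)) (φ : (Fin n → k) →ₗ[k] k)
    (b : Fin n → k) :
    transport g (squareStr φ b) = squareStr (φ ∘ₗ g.symm.toLinearMap) (g b) := by
  refine LinearMap.ext₂ fun x y => ?_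
  simp

theorem dual_apply_eq_sum (φ : (Fin n → k) →ₗ[k] k) (b : Fin n → k) :
    φ b = ∑ m, b m * φ (Pi.single m 1) := by
  conv_lhs => rw [pi_eq_sum_univ' b]
  simp [map_sum]

/-- A degeneration of `A₃ ⊕ kⁿ⁻²` is zero or is of the same kind. -/
theorem eq_zero_or_squareStr_of_degenerates {φ : (Fin n → k) →ₗ[k] k} {b : Fin n → k}
    (hφb : φ b = 0) {χ : AlgStr k n} (h : degenerates (squareStr φ b) χ) :
    χ = 0 ∨ ∃ (ψ : (Fin n → k) →ₗ[k] k) (d : Fin n → k), ψ ≠ 0 ∧ d ≠ 0 ∧ ψ d = 0 ∧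
      χ = squareStr ψ d := by
  set c : Fin n → Fin n → Fin n → k := fun i j m => structConst χ (i, j, m) with hc
  have hswap : ∀ i j m p q r, c i j m * c p q r = c p j m * c i q r := by
    intro i j m p q r
    rw [← sub_eq_zero]
    have := eval_eq_zero_of_mem_zclosure h
      (MvPolynomial.X (i, j, m) * MvPolynomial.X (p, q, r)
        - MvPolynomial.X (p, j, m) * MvPolynomial.X (i, q, r)) ?_
    · simpa using this
    · rintro _ ⟨g, rfl⟩
      rw [transport_squareStr]
      simp only [map_sub, map_mul, MvPolynomial.eval_X, structConst_squareStr]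
      ring
  have hout : ∀ i j m p q r, c i j m * c p q r = c i j r * c p q m := by
    intro i j m p q r
    rw [← sub_eq_zero]
    have := eval_eq_zero_of_mem_zclosure h
      (MvPolynomial.X (i, j, m) * MvPolynomial.X (p, q, r)
        - MvPolynomial.X (i, j, r) * MvPolynomial.X (p, q, m)) ?_
    · simpa using this
    · rintro _ ⟨g, rfl⟩
      rw [transport_squareStr]
      simp only [map_sub, map_mul, MvPolynomial.eval_X, structConst_squareStr]
      ring
  have hcomm : ∀ i j m, c i j m = c j i m := by
    intro i j m
    rw [← sub_eq_zero]
    have := eval_eq_zero_of_mem_zclosure h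
      (MvPolynomial.X (i, j, m) - MvPolynomial.X (j, i, m)) ?_
    · simpa using this
    · rintro _ ⟨g, rfl⟩
      rw [transport_squareStr]
      simp only [map_sub, MvPolynomial.eval_X, structConst_squareStr]
      ring
  have hnil : ∀ i j p r, ∑ m, c i j m * c m p r = 0 := by
    intro i j p r
    have := eval_eq_zero_of_mem_zclosure h
      (∑ m, MvPolynomial.X (i, j, m) * MvPolynomial.X (m, p, r)) ?_
    · simpa using this
    · rintro _ ⟨g, rfl⟩
      rw [transport_squareStr]
      simp only [map_sum, map_mul, MvPolynomial.eval_X, structConst_squareStr]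
      have h0 := dual_apply_eq_sum (φ ∘ₗ g.symm.toLinearMap) (g b)
      rw [LinearMap.comp_apply, LinearEquiv.coe_coe, LinearEquiv.symm_apply_apply, hφb] at h0
      set ψ := φ ∘ₗ g.symm.toLinearMap
      calc _ = ∑ m, (ψ (Pi.single i 1) * ψ (Pi.single j 1) * ψ (Pi.single p 1) * g b r) *
              (g b m * ψ (Pi.single m 1)) := Finset.sum_congr rfl fun m _ => by ring
        _ = 0 := by rw [← Finset.mul_sum, ← h0, mul_zero]
  by_cases h0 : ∀ t, structConst χ t = 0
  · exact Or.inl (eq_zero_of_structConst h0)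
  right
  push Not at h0
  obtain ⟨⟨p, q, r⟩, hpqr⟩ := h0
  change c p q r ≠ 0 at hpqr
  have hβ : c p p r ≠ 0 := by
    intro h1
    have h2 := hswap p q r q p r
    rw [h1, mul_zero, hcomm q p r] at h2
    exact hpqr (mul_self_eq_zero.1 h2)
  let ψ : (Fin n → k) →ₗ[k] k := ∑ i, (c i p r / c p p r) • LinearMap.proj i
  have hψ : ∀ i, ψ (Pi.single i 1) = c i p r / c p p r := by
    intro i
    simp [ψ, LinearMap.sum_apply, Pi.single_apply]
  refine ⟨ψ, fun m => c p p m, ?_, ?_, ?_, ?_⟩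
  · intro h1
    have := hψ p
    rw [h1, div_self hβ] at this
    simp at this
  · intro h1
    exact hβ (congrFun h1 r)
  · rw [dual_apply_eq_sum]
    simp only [hψ, mul_div_assoc']
    rw [← Finset.sum_div, hnil, zero_div]
  · refine algStr_ext_structConst ?_
    rintro ⟨i, j, m⟩
    rw [structConst_squareStr, hψ, hψ]
    change c i j m = _
    have h1 := hswap i j m p p r
    have h2 := hout j p m p p r
    rw [hcomm p j m] at h1
    field_simp
    linear_combination c p p r * h1 + c i p r * h2

theorem not_hasChain_two_squareStr {φ : (Fin n → k) →ₗ[k] k} {b : Fin n → k}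
    (hφ : φ ≠ 0) (hb : b ≠ 0) (hφb : φ b = 0) : ¬ hasChain (squareStr φ b) 2 := by
  rintro ⟨c, hc, hdeg⟩
  have h1 := hdeg 1 (by norm_num)
  have h0 := hdeg 0 (by norm_num)
  norm_num [hc] at h0 h1
  rcases eq_zero_or_squareStr_of_degenerates hφb h1.1 with hz | ⟨ψ, d, hψ, hd, hψd, he⟩
  · rw [hz] at h0
    have := eq_zero_of_degenerates_zero h0.1
    exact h0.2 ⟨LinearEquiv.refl k _, by rw [this]; rfl⟩
  · exact h1.2 (he ▸ squareStr_mem_orbit hφ hψ hb hd hφb hψd)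

theorem hasChain_three {μ χ₂ χ₁ : AlgStr k n} [Infinite k] (h₂ : properlyDegenerates μ χ₂)
    (h₁ : properlyDegenerates χ₂ χ₁) (h₀ : χ₁ ≠ 0) : hasChain μ 3 := by
  refine ⟨fun i => match i with | 0 => 0 | 1 => χ₁ | 2 => χ₂ | _ => μ, rfl, ?_⟩
  intro i hi
  interval_cases i
  · exact ⟨degenerates_zero _, fun h => h₀ (eq_zero_of_zero_mem_orbit h)⟩
  · exact h₁
  · exact h₂

end Degeneration

section SingularExtension

variable {n : ℕ}

/-- A decomposition of `μ` as a trivial singular extension of `A₃` by the square-zero ideal `I`,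
with `p₁`, `p₂` the coordinates along `f₁`, `f₂`, and `π` the projection onto `I`. -/
structure SingularExt (μ : AlgStr k n) where
  I : Submodule k (Fin n → k)
  f₁ : Fin n → k
  f₂ : Fin n → k
  p₁ : (Fin n → k) →ₗ[k] k
  p₂ : (Fin n → k) →ₗ[k] k
  π : (Fin n → k) →ₗ[k] (Fin n → k)
  p₁_f₁ : p₁ f₁ = 1
  p₁_f₂ : p₁ f₂ = 0
  p₂_f₁ : p₂ f₁ = 0
  p₂_f₂ : p₂ f₂ = 1
  p₁_mem : ∀ v ∈ I, p₁ v = 0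
  p₂_mem : ∀ v ∈ I, p₂ v = 0
  π_mem : ∀ x, π x ∈ I
  decomp : ∀ x, x = p₁ x • f₁ + p₂ x • f₂ + π x
  mul_mem_right : ∀ x ∈ I, ∀ y, μ x y ∈ I
  mul_mem_left : ∀ x ∈ I, ∀ y, μ y x ∈ I
  mul_I : ∀ x ∈ I, ∀ y ∈ I, μ x y = 0
  mul₁₁ : μ f₁ f₁ = f₂
  mul₁₂ : μ f₁ f₂ = 0
  mul₂₁ : μ f₂ f₁ = 0
  mul₂₂ : μ f₂ f₂ = 0

theorem exists_dual_separating {I : Submodule k (Fin n → k)} {a b : Fin n → k}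
    (h : ∀ s t : k, s • a + t • b ∈ I → s = 0 ∧ t = 0) :
    ∃ p : (Fin n → k) →ₗ[k] k, p a = 1 ∧ p b = 0 ∧ ∀ v ∈ I, p v = 0 := by
  have ha : a ∉ Submodule.span k {b} ⊔ I := by
    intro ha
    obtain ⟨x, hx, i, hi, hxi⟩ := Submodule.mem_sup.1 ha
    obtain ⟨t, rfl⟩ := Submodule.mem_span_singleton.1 hx
    have := h 1 (-t) (by rw [← hxi]; convert hi using 1; module)
    exact one_ne_zero this.1
  obtain ⟨p, hpa, hp⟩ := Submodule.exists_le_ker_of_notMem ha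
  refine ⟨(p a)⁻¹ • p, by simp [hpa], ?_, fun v hv => ?_⟩
  · have : p b = 0 := hp (Submodule.mem_sup_left (Submodule.mem_span_singleton_self b))
    simp [this]
  · have : p v = 0 := hp (Submodule.mem_sup_right hv)
    simp [this]

theorem nonempty_singularExt {μ : AlgStr k n} {I B₀ : Submodule k (Fin n → k)}
    (hI : ∀ x ∈ I, ∀ y : Fin n → k, μ x y ∈ I ∧ μ y x ∈ I)
    (hII : ∀ x ∈ I, ∀ y ∈ I, μ x y = 0) (hc : IsCompl B₀ I)
    (hdim : Module.finrank k ↥B₀ = 2) {f₁ f₂ : Fin n → k}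
    (hspan : Submodule.span k {f₁, f₂} = B₀) (h₁₁ : μ f₁ f₁ = f₂) (h₁₂ : μ f₁ f₂ = 0)
    (h₂₁ : μ f₂ f₁ = 0) (h₂₂ : μ f₂ f₂ = 0) : Nonempty (SingularExt μ) := by
  have hli : LinearIndependent k ![f₁, f₂] := by
    rw [linearIndependent_iff_card_eq_finrank_span, Set.finrank, Matrix.range_cons,
      Matrix.range_cons, Matrix.range_empty, Set.union_empty, Set.singleton_union, hspan, hdim]
    rfl
  have hmem : ∀ s t : k, s • f₁ + t • f₂ ∈ B₀ := fun s t => by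
    rw [← hspan]; exact Submodule.mem_span_pair.2 ⟨s, t, rfl⟩
  have hind : ∀ s t : k, s • f₁ + t • f₂ ∈ I → s = 0 ∧ t = 0 := fun s t hst =>
    LinearIndependent.pair_iff.1 hli s t (Submodule.disjoint_def.1 hc.disjoint _ (hmem s t) hst)
  obtain ⟨p₁, h1, h2, h3⟩ := exists_dual_separating hind
  obtain ⟨p₂, h4, h5, h6⟩ := exists_dual_separating (I := I) (a := f₂) (b := f₁)
    fun s t hst => (hind t s (by rwa [add_comm])).symm
  refine ⟨⟨I, f₁, f₂, p₁, p₂, LinearMap.id - p₁.smulRight f₁ - p₂.smulRight f₂, h1, h2, h5, h4,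
    h3, h6, fun x => ?_, fun x => ?_, fun x hx y => (hI x hx y).1, fun x hx y => (hI x hx y).2,
    hII, h₁₁, h₁₂, h₂₁, h₂₂⟩⟩
  · have hx : x ∈ B₀ ⊔ I := by rw [hc.sup_eq_top]; trivial
    obtain ⟨b, hb, i, hi, rfl⟩ := Submodule.mem_sup.1 hx
    rw [← hspan] at hb
    obtain ⟨s, t, rfl⟩ := Submodule.mem_span_pair.1 hb
    convert hi using 1
    simp [h1, h2, h3 i hi, h4, h5, h6 i hi]
    abel
  · simp only [LinearMap.sub_apply, LinearMap.id_apply, LinearMap.smulRight_apply]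
    module

namespace SingularExt

variable {μ : AlgStr k n} (E : SingularExt μ)

theorem f₂_ne_zero : E.f₂ ≠ 0 := by
  intro h
  simpa [h] using E.p₂_f₂

theorem p₁_ne_zero : E.p₁ ≠ 0 := by
  intro h
  simpa [h] using E.p₁_f₁

theorem π_of_mem {v : Fin n → k} (hv : v ∈ E.I) : E.π v = v := by
  have := E.decomp v
  rw [E.p₁_mem v hv, E.p₂_mem v hv] at this
  simpa using this.symm

theorem π_f₁ : E.π E.f₁ = 0 := by
  have := E.decomp E.f₁
  rw [E.p₁_f₁, E.p₂_f₁] at this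
  simpa using this

theorem π_f₂ : E.π E.f₂ = 0 := by
  have := E.decomp E.f₂
  rw [E.p₁_f₂, E.p₂_f₂] at this
  simpa using this

theorem mul_eq_of_mem {v w : Fin n → k} (hv : v ∈ E.I) (hw : w ∈ E.I) (a b c d : k) :
    μ (a • E.f₁ + b • E.f₂ + v) (c • E.f₁ + d • E.f₂ + w) =
      (a * c) • E.f₂ + a • μ E.f₁ w + c • μ v E.f₁ + b • μ E.f₂ w + d • μ v E.f₂ := by
  simp only [map_add, map_smul, LinearMap.add_apply, LinearMap.smul_apply, E.mul₁₁, E.mul₁₂,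
    E.mul₂₁, E.mul₂₂, E.mul_I v hv w hw]
  module

theorem mul_eq (x y : Fin n → k) :
    μ x y = (E.p₁ x * E.p₁ y) • E.f₂ + E.p₁ x • μ E.f₁ (E.π y) + E.p₁ y • μ (E.π x) E.f₁
      + E.p₂ x • μ E.f₂ (E.π y) + E.p₂ y • μ (E.π x) E.f₂ := by
  conv_lhs => rw [E.decomp x, E.decomp y]
  exact E.mul_eq_of_mem (E.π_mem x) (E.π_mem y) _ _ _ _

/-- The operator `v ↦ f₁ v + v f₁`. -/
def D : (Fin n → k) →ₗ[k] (Fin n → k) := μ E.f₁ + μ.flip E.f₁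

theorem D_apply (v : Fin n → k) : E.D v = μ E.f₁ v + μ v E.f₁ := rfl

theorem D_mem {v : Fin n → k} (hv : v ∈ E.I) : E.D v ∈ E.I :=
  add_mem (E.mul_mem_left v hv _) (E.mul_mem_right v hv _)

theorem self_mem_subalgGen (a : Fin n → k) : a ∈ subalgGen μ {a} :=
  Submodule.mem_sInf.2 fun _ hp => hp.1 rfl

theorem mul_mem_subalgGen (a x y : Fin n → k) (hx : x ∈ subalgGen μ {a})
    (hy : y ∈ subalgGen μ {a}) : μ x y ∈ subalgGen μ {a} :=
  Submodule.mem_sInf.2 fun p hp =>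
    hp.2 _ (Submodule.mem_sInf.1 hx p hp) _ (Submodule.mem_sInf.1 hy p hp)

theorem sq_mem_subalgGen {v : Fin n → k} (hv : v ∈ E.I) :
    E.f₂ + E.D v ∈ subalgGen μ {E.f₁ + v} := by
  have h := E.mul_eq_of_mem hv hv 1 0 1 0
  simp only [one_smul, zero_smul, add_zero, mul_one] at h
  rw [D_apply, ← add_assoc, ← h]
  exact mul_mem_subalgGen _ _ _ (self_mem_subalgGen _) (self_mem_subalgGen _)

/-- If `G(A) = 2`, the subalgebra generated by `f₁ + v` meets `I` trivially. -/
theorem eq_zero_of_mem_subalgGen (hG : genType μ 2) {v u : Fin n → k} (hv : v ∈ E.I)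
    (hu : u ∈ subalgGen μ {E.f₁ + v}) (huI : u ∈ E.I) : u = 0 := by
  by_contra hu0
  have hle : Module.finrank k ↥(subalgGen μ {E.f₁ + v}) ≤ 2 := hG.2 ⟨_, rfl⟩
  have hli : LinearIndependent k ![(⟨_, self_mem_subalgGen _⟩ : subalgGen μ {E.f₁ + v}),
      ⟨_, E.sq_mem_subalgGen hv⟩, ⟨u, hu⟩] := by
    rw [Fintype.linearIndependent_iff]
    intro c hc
    have hc' : c 0 • (E.f₁ + v) + c 1 • (E.f₂ + E.D v) + c 2 • u = 0 := by
      simpa [Fin.sum_univ_three] using congrArg Subtype.val hc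
    have h0 : c 0 = 0 := by
      simpa [E.p₁_f₁, E.p₁_f₂, E.p₁_mem _ hv, E.p₁_mem _ (E.D_mem hv), E.p₁_mem _ huI]
        using congrArg E.p₁ hc'
    have h1 : c 1 = 0 := by
      simpa [E.p₂_f₁, E.p₂_f₂, E.p₂_mem _ hv, E.p₂_mem _ (E.D_mem hv), E.p₂_mem _ huI]
        using congrArg E.p₂ hc'
    have h2 : c 2 = 0 := by simpa [h0, h1, hu0] using hc'
    intro i
    fin_cases i <;> assumption
  have := hli.fintype_card_le_finrank
  simp at this
  omega

theorem generation_relations (hG : genType μ 2) {v : Fin n → k} (hv : v ∈ E.I) :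
    μ E.f₁ (E.D v) + μ v E.f₂ = 0 ∧ μ (E.D v) E.f₁ + μ E.f₂ v = 0 ∧
      μ E.f₂ (E.D v) + μ (E.D v) E.f₂ = 0 := by
  have hDv := E.D_mem hv
  have ha := self_mem_subalgGen (μ := μ) (E.f₁ + v)
  have haa := E.sq_mem_subalgGen hv
  have h1 := mul_mem_subalgGen _ _ _ ha haa
  have h2 := mul_mem_subalgGen _ _ _ haa ha
  have h3 := mul_mem_subalgGen _ _ _ haa haa
  have e1 := E.mul_eq_of_mem hv hDv 1 0 0 1
  have e2 := E.mul_eq_of_mem hDv hv 0 1 1 0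
  have e3 := E.mul_eq_of_mem hDv hDv 0 1 0 1
  simp only [one_smul, zero_smul, add_zero, zero_add, mul_one, mul_zero] at e1 e2 e3
  rw [e1] at h1
  rw [e2] at h2
  rw [e3] at h3
  exact ⟨E.eq_zero_of_mem_subalgGen hG hv h1
      (add_mem (E.mul_mem_left _ hDv _) (E.mul_mem_right _ hv _)),
    E.eq_zero_of_mem_subalgGen hG hv h2
      (add_mem (E.mul_mem_right _ hDv _) (E.mul_mem_left _ hv _)),
    E.eq_zero_of_mem_subalgGen hG hv h3
      (add_mem (E.mul_mem_left _ hDv _) (E.mul_mem_right _ hDv _))⟩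

theorem mul_f₂_add_f₂_mul (hG : genType μ 2) {v : Fin n → k} (hv : v ∈ E.I) :
    μ E.f₂ v + μ v E.f₂ = -E.D (E.D v) := by
  obtain ⟨h1, h2, -⟩ := E.generation_relations hG hv
  rw [eq_neg_iff_add_eq_zero, E.D_apply (E.D v)]
  calc _ = (μ E.f₁ (E.D v) + μ v E.f₂) + (μ (E.D v) E.f₁ + μ E.f₂ v) := by abel
    _ = 0 := by rw [h1, h2, add_zero]

theorem D_D_D_eq_zero (hG : genType μ 2) {v : Fin n → k} (hv : v ∈ E.I) :
    E.D (E.D (E.D v)) = 0 := by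
  rw [← neg_eq_zero, ← E.mul_f₂_add_f₂_mul hG (E.D_mem hv)]
  exact (E.generation_relations hG hv).2.2

theorem eq_squareStr (hG : genType μ 2)
    (h : ∀ v ∈ E.I, μ E.f₁ v = 0 ∧ μ v E.f₁ = 0) : μ = squareStr E.p₁ E.f₂ := by
  have hD : ∀ v ∈ E.I, E.D v = 0 := fun v hv => by
    rw [D_apply, (h v hv).1, (h v hv).2, add_zero]
  refine LinearMap.ext₂ fun x y => ?_
  have hx := E.generation_relations hG (E.π_mem x)
  have hy := E.generation_relations hG (E.π_mem y)
  rw [hD _ (E.π_mem _)] at hx hy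
  simp only [map_zero, LinearMap.zero_apply, zero_add] at hx hy
  rw [E.mul_eq, hx.1, hy.2.1, (h _ (E.π_mem x)).2, (h _ (E.π_mem y)).1]
  simp

/-- The form `B` such that `μ` degenerates to `(x, y) ↦ B(x, y) f₂`, built from a functional
`θ` that is used to collapse `I` onto the line of `f₂`. -/
def form (θ : (Fin n → k) →ₗ[k] k) : (Fin n → k) →ₗ[k] (Fin n → k) →ₗ[k] k :=
  E.p₁.smulRight E.p₁ + E.p₁.smulRight (θ ∘ₗ μ E.f₁ ∘ₗ E.π)
    + (θ ∘ₗ μ.flip E.f₁ ∘ₗ E.π).smulRight E.p₁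
    - (θ ∘ₗ E.π).smulRight (θ ∘ₗ μ E.f₂ ∘ₗ E.π)
    - (θ ∘ₗ μ.flip E.f₂ ∘ₗ E.π).smulRight (θ ∘ₗ E.π)

theorem form_apply (θ : (Fin n → k) →ₗ[k] k) (x y : Fin n → k) :
    E.form θ x y = E.p₁ x * E.p₁ y + E.p₁ x * θ (μ E.f₁ (E.π y))
      + θ (μ (E.π x) E.f₁) * E.p₁ y - θ (E.π x) * θ (μ E.f₂ (E.π y))
      - θ (μ (E.π x) E.f₂) * θ (E.π y) := by
  simp [form]

theorem degenerates_formStr [Infinite k] (θ : (Fin n → k) →ₗ[k] k) :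
    degenerates μ (formStr (E.form θ) E.f₂) := by
  refine degenerates_of_curve μ _
    (fun x y => E.p₁ x • μ E.f₁ (E.π y) + E.p₁ y • μ (E.π x) E.f₁ - θ (E.π x) • μ E.f₂ (E.π y)
      - θ (E.π y) • μ (E.π x) E.f₂
      + (E.p₂ x * θ (μ E.f₂ (E.π y)) + E.p₂ y * θ (μ (E.π x) E.f₂)) • E.f₂)
    (fun x y => E.p₂ x • μ E.f₂ (E.π y) + E.p₂ y • μ (E.π x) E.f₂)
    (fun t => (t • E.p₁).smulRight E.f₁ + (t ^ 2 • E.p₂ - t • θ ∘ₗ E.π).smulRight E.f₂ + E.π)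
    ?_ ?_
  · intro t ht x hx
    simp only [LinearMap.add_apply, LinearMap.smulRight_apply, LinearMap.smul_apply,
      LinearMap.sub_apply, LinearMap.comp_apply, smul_eq_mul] at hx
    have h1 := congrArg E.p₁ hx
    simp only [map_add, map_smul, E.p₁_f₁, E.p₁_f₂, E.p₁_mem _ (E.π_mem x), smul_eq_mul, mul_one,
      mul_zero, add_zero, map_zero, mul_eq_zero, ht, false_or] at h1
    have h2 := congrArg E.π hx
    simp only [map_add, map_smul, E.π_f₁, E.π_f₂, E.π_of_mem (E.π_mem x), smul_zero, zero_add,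
      map_zero] at h2
    have h3 := congrArg E.p₂ hx
    simp only [map_add, map_smul, E.p₂_f₁, E.p₂_f₂, h2, smul_eq_mul,
      mul_one, mul_zero, add_zero, zero_add, map_zero, sub_zero, mul_eq_zero, pow_eq_zero_iff,
      ne_eq, OfNat.ofNat_ne_zero, not_false_eq_true, ht, false_or] at h3
    rw [E.decomp x, h1, h2, h3]
    simp
  · intro t _ x y
    set h := (t • E.p₁).smulRight E.f₁ + (t ^ 2 • E.p₂ - t • θ ∘ₗ E.π).smulRight E.f₂ + E.π
      with hh
    have hx : ∀ x, h x = (t * E.p₁ x) • E.f₁ + (t ^ 2 * E.p₂ x - t * θ (E.π x)) • E.f₂ + E.π x :=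
      fun x => by simp [hh]
    have hf₂ : h E.f₂ = t ^ 2 • E.f₂ := by
      rw [hx, E.p₁_f₂, E.p₂_f₂, E.π_f₂]; simp
    have hI : ∀ u ∈ E.I, h u = u - (t * θ u) • E.f₂ := fun u hu => by
      rw [hx, E.p₁_mem u hu, E.p₂_mem u hu, E.π_of_mem hu]; simp; abel
    have hl := fun a => hI _ (E.mul_mem_left _ (E.π_mem y) a)
    have hr := fun a => hI _ (E.mul_mem_right _ (E.π_mem x) a)
    rw [hx x, hx y, E.mul_eq_of_mem (E.π_mem x) (E.π_mem y), formStr_apply, form_apply]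
    simp only [map_add, map_sub, map_smul, hf₂, hl, hr]
    module

theorem formStr_degenerates_squareStr [Infinite k] (θ : (Fin n → k) →ₗ[k] k) :
    degenerates (formStr (E.form θ) E.f₂) (squareStr E.p₁ E.f₂) := by
  refine degenerates_of_curve _ _
    (fun x y => (E.p₁ x * θ (μ E.f₁ (E.π y)) + θ (μ (E.π x) E.f₁) * E.p₁ y) • E.f₂)
    (fun x y => (- θ (E.π x) * θ (μ E.f₂ (E.π y)) - θ (μ (E.π x) E.f₂) * θ (E.π y)) • E.f₂)
    (fun t => E.p₁.smulRight E.f₁ + E.p₂.smulRight E.f₂ + t • E.π) ?_ ?_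
  · intro t ht x hx
    simp only [LinearMap.add_apply, LinearMap.smulRight_apply, LinearMap.smul_apply] at hx
    have h1 := congrArg E.p₁ hx
    simp only [map_add, map_smul, E.p₁_f₁, E.p₁_f₂, E.p₁_mem _ (E.π_mem x), smul_eq_mul, mul_one,
      mul_zero, add_zero, map_zero] at h1
    have h2 := congrArg E.π hx
    simp only [map_add, map_smul, E.π_f₁, E.π_f₂, E.π_of_mem (E.π_mem x), smul_zero, zero_add,
      map_zero, smul_eq_zero, ht, false_or] at h2
    have h3 := congrArg E.p₂ hx
    simp only [map_add, map_smul, E.p₂_f₁, E.p₂_f₂, E.p₂_mem _ (E.π_mem x), smul_eq_mul,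
      mul_one, mul_zero, add_zero, zero_add, map_zero] at h3
    rw [E.decomp x, h1, h2, h3]
    simp
  · intro t _ x y
    set h := E.p₁.smulRight E.f₁ + E.p₂.smulRight E.f₂ + t • E.π with hh
    have hx : ∀ x, h x = E.p₁ x • E.f₁ + E.p₂ x • E.f₂ + t • E.π x := fun x => by simp [hh]
    have hf₂ : h E.f₂ = E.f₂ := by
      rw [hx, E.p₁_f₂, E.p₂_f₂, E.π_f₂]; simp
    have hp₁ : ∀ x, E.p₁ (h x) = E.p₁ x := fun x => by
      simp [hx, E.p₁_f₁, E.p₁_f₂, E.p₁_mem _ (E.π_mem x)]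
    have hπ : ∀ x, E.π (h x) = t • E.π x := fun x => by
      simp [hx, E.π_f₁, E.π_f₂, E.π_of_mem (E.π_mem x)]
    rw [formStr_apply, form_apply, squareStr_apply]
    simp only [map_add, map_smul, hf₂, hp₁, hπ, LinearMap.smul_apply, smul_eq_mul]
    module

theorem formStr_notMem_orbit (θ : (Fin n → k) →ₗ[k] k)
    (h : ∃ v ∈ E.I, μ E.f₁ v ≠ 0 ∨ μ v E.f₁ ≠ 0) : formStr (E.form θ) E.f₂ ∉ orbit μ := by
  rintro ⟨g, hg⟩
  have hmul : ∀ x y, μ x y = E.form θ (g x) (g y) • g.symm E.f₂ := fun x y => by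
    have := congrArg g.symm (LinearMap.congr_fun₂ hg (g x) (g y))
    simpa using this
  have hline : ∀ x y, μ x y ∈ E.I → μ x y = 0 := fun x y hxy => by
    have h₂ := hmul E.f₁ E.f₁
    rw [E.mul₁₁] at h₂
    set α := E.form θ (g E.f₁) (g E.f₁)
    have h3 := congrArg E.p₂ (show α • μ x y = E.form θ (g x) (g y) • E.f₂ by
      conv_rhs => rw [h₂]
      rw [hmul x y, smul_smul, smul_smul, mul_comm])
    rw [map_smul, map_smul, E.p₂_f₂, E.p₂_mem _ hxy] at h3
    rw [hmul x y, show E.form θ (g x) (g y) = 0 by simpa using h3.symm, zero_smul]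
  obtain ⟨v, hv, h | h⟩ := h
  · exact h (hline _ _ (E.mul_mem_left v hv _))
  · exact h (hline _ _ (E.mul_mem_right v hv _))

theorem squareStr_notMem_orbit (hG : genType μ 2) {θ : (Fin n → k) →ₗ[k] k}
    (h : ∃ v ∈ E.I, θ (μ E.f₁ v) ≠ 0 ∨ θ (μ v E.f₁) ≠ 0) :
    squareStr E.p₁ E.f₂ ∉ orbit (formStr (E.form θ) E.f₂) := by
  rintro ⟨g, hg⟩
  have hB : ∀ x y, E.form θ x y = E.p₁ (g x) * E.p₁ (g y) * E.p₂ (g.symm E.f₂) := fun x y => by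
    have := congrArg (fun z => E.p₂ (g.symm z)) (LinearMap.congr_fun₂ hg (g x) (g y))
    simpa [E.p₂_f₂] using this
  have h11 : E.form θ E.f₁ E.f₁ = 1 := by
    simp [form_apply, E.p₁_f₁, E.π_f₁]
  have hl : ∀ v ∈ E.I, E.form θ E.f₁ v = θ (μ E.f₁ v) := fun v hv => by
    simp [form_apply, E.p₁_f₁, E.π_f₁, E.p₁_mem v hv, E.π_of_mem hv]
  have hr : ∀ v ∈ E.I, E.form θ v E.f₁ = θ (μ v E.f₁) := fun v hv => by
    simp [form_apply, E.p₁_f₁, E.π_f₁, E.p₁_mem v hv, E.π_of_mem hv]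
  have hsymm : ∀ v ∈ E.I, θ (μ v E.f₁) = θ (μ E.f₁ v) := fun v hv => by
    rw [← hl v hv, ← hr v hv, hB, hB]
    ring
  have hsq : ∀ v ∈ E.I, θ (μ E.f₁ v) ^ 2 = θ v * θ (E.D (E.D v)) := fun v hv => by
    have h1 : E.form θ v v = θ v * θ (E.D (E.D v)) := by
      have h2 := congrArg θ (E.mul_f₂_add_f₂_mul hG hv)
      rw [map_add, map_neg] at h2
      simp only [form_apply, E.p₁_mem v hv, E.π_of_mem hv]
      linear_combination (-θ v) * h2
    rw [← h1, ← hl v hv]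
    rw [hB] at h11
    rw [hB, hB]
    linear_combination (E.p₁ (g v) ^ 2 * E.p₂ (g.symm E.f₂)) * h11
  have hzero : ∀ v ∈ E.I, θ (μ E.f₁ v) = 0 := fun v hv => by
    have hDv := E.D_mem hv
    have h1 := hsq _ hDv
    rw [E.D_D_D_eq_zero hG hv, map_zero, mul_zero, sq_eq_zero_iff] at h1
    have h2 := hsq v hv
    rwa [E.D_apply (E.D v), map_add, hsymm _ hDv, h1, add_zero, mul_zero, sq_eq_zero_iff] at h2
  obtain ⟨v, hv, h | h⟩ := h
  · exact h (hzero v hv)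
  · exact h (by rw [hsymm v hv, hzero v hv])

theorem hasChain_three [Infinite k] (hG : genType μ 2)
    (h : ∃ v ∈ E.I, μ E.f₁ v ≠ 0 ∨ μ v E.f₁ ≠ 0) : hasChain μ 3 := by
  obtain ⟨θ, hθ⟩ : ∃ θ : (Fin n → k) →ₗ[k] k,
      ∃ v ∈ E.I, θ (μ E.f₁ v) ≠ 0 ∨ θ (μ v E.f₁) ≠ 0 := by
    have hsep : ∀ u : Fin n → k, u ≠ 0 → ∃ θ : (Fin n → k) →ₗ[k] k, θ u ≠ 0 := fun u hu => by
      by_contra! hc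
      exact hu ((Module.forall_dual_apply_eq_zero_iff k u).1 hc)
    obtain ⟨v, hv, h | h⟩ := h
    · obtain ⟨θ, hθ⟩ := hsep _ h
      exact ⟨θ, v, hv, Or.inl hθ⟩
    · obtain ⟨θ, hθ⟩ := hsep _ h
      exact ⟨θ, v, hv, Or.inr hθ⟩
  refine _root_.hasChain_three ⟨E.degenerates_formStr θ, E.formStr_notMem_orbit θ h⟩
    ⟨E.formStr_degenerates_squareStr θ, E.squareStr_notMem_orbit hG hθ⟩ fun h0 => ?_
  have := LinearMap.congr_fun₂ h0 E.f₁ E.f₁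
  simp [E.p₁_f₁, E.f₂_ne_zero] at this

end SingularExt

end SingularExtension

/-! ## STATEMENT 16 -/
theorem stmt16 {k : Type*} [Field k] [IsAlgClosed k] (n : ℕ) (μ : AlgStr k n)
    (hext : ∃ I B0 : Submodule k (Fin n → k),
      (∀ x ∈ I, ∀ y : Fin n → k, μ x y ∈ I ∧ μ y x ∈ I) ∧
      (∀ x ∈ I, ∀ y ∈ I, μ x y = 0) ∧
      IsCompl B0 I ∧ Module.finrank k ↥B0 = 2 ∧
      ∃ f1 f2 : Fin n → k, Submodule.span k {f1, f2} = B0 ∧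
        μ f1 f1 = f2 ∧ μ f1 f2 = 0 ∧ μ f2 f1 = 0 ∧ μ f2 f2 = 0)
    (hG : genType μ 2) : ¬ levelIs μ 2 := by
  obtain ⟨I, B0, hI, hII, hc, hdim, f1, f2, hspan, h11, h12, h21, h22⟩ := hext
  obtain ⟨E⟩ := nonempty_singularExt hI hII hc hdim hspan h11 h12 h21 h22
  by_cases h : ∃ v ∈ E.I, μ E.f₁ v ≠ 0 ∨ μ v E.f₁ ≠ 0
  · exact fun hlev => hlev.2 (E.hasChain_three hG h)
  · push Not at h
    rw [E.eq_squareStr hG h]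
    exact fun hlev => not_hasChain_two_squareStr E.p₁_ne_zero E.f₂_ne_zero E.p₁_f₂ hlev.1

end
end

section
/- Let A be an n-dimensional algebra of a nonantisymmetric bilinear form, i.e., A is represented by a structure μ ∈ A_n whose structure constants μ_{i,j}^m vanish unless 1 ≤ i,j ≤ n−1 and m = n, and such that μ(v,v) ≠ 0 for some v ∈ V. Then lev(A) ≥ n − dim Ann(A), where Ann(A) = {a ∈ A : ab = ba = 0 for all b ∈ A}. -/
open scoped BigOperators

noncomputable section

variable {k : Type*} [Field k]

open Module in
/-- A non-alternating bilinear form whose two-sided radical `N` has codimension at least `2`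
restricts to a non-alternating form with two-sided radical `N` on a suitable hyperplane
`ker φ ⊇ N`. -/
theorem exists_hyperplane_radical_eq [Infinite k] {V : Type*} [AddCommGroup V] [Module k V]
    [FiniteDimensional k V] (B : V →ₗ[k] V →ₗ[k] k) (N : Submodule k V)
    (hN : ∀ x, x ∈ N ↔ ∀ y, B x y = 0 ∧ B y x = 0)
    (hdim : finrank k N + 2 ≤ finrank k V) (hB : ∃ v, B v v ≠ 0) :
    ∃ (φ : V →ₗ[k] k) (u w : V), φ w = 1 ∧ φ u = 0 ∧ B u u ≠ 0 ∧ (∀ x ∈ N, φ x = 0) ∧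
      ∀ x, φ x = 0 → (∀ y, φ y = 0 → B x y = 0 ∧ B y x = 0) → x ∈ N := by
  obtain ⟨v, hv⟩ := hB
  by_cases hker : ∃ z, B z = 0 ∧ z ∉ N
  · have proportional : ∀ (φ f : V →ₗ[k] k) (w : V), φ w ≠ 0 →
        (∀ y, φ y = 0 → f y = 0) → ∃ a : k, f = a • φ := by
      intro φ f w hw h
      refine ⟨f w / φ w, LinearMap.ext fun y => ?_⟩
      have := h (y - (φ y / φ w) • w) (by simp [hw])
      simp only [map_sub, map_smul, smul_eq_mul] at this
      simp only [LinearMap.smul_apply, smul_eq_mul]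
      rw [sub_eq_zero.mp this]
      field_simp
    obtain ⟨z, hz, hzN⟩ := hker
    have memD : ∀ x, B x ∈ N.dualAnnihilator ∧ B.flip x ∈ N.dualAnnihilator := by
      intro x
      simp only [Submodule.mem_dualAnnihilator, LinearMap.flip_apply]
      exact ⟨fun y hy => ((hN y).1 hy x).2, fun y hy => ((hN y).1 hy x).1⟩
    have hL : ∃ φ ∈ N.dualAnnihilator, φ ∉ LinearMap.range B := by
      by_contra! hcon
      have h1 : finrank k N.dualAnnihilator ≤ finrank k (LinearMap.range B) :=
        Submodule.finrank_mono hcon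
      have h2 := LinearMap.finrank_range_add_finrank_ker B
      have h3 := Subspace.finrank_add_finrank_dualAnnihilator_eq N
      have h4 : N < LinearMap.ker B := by
        refine lt_of_le_of_ne (fun x hx => ?_) (fun h => hzN (h ▸ hz))
        exact LinearMap.ext fun y => ((hN x).1 hx y).1
      have h5 := Submodule.finrank_lt_finrank_of_lt h4
      omega
    have hR : ∃ φ ∈ N.dualAnnihilator, φ ∉ LinearMap.range B.flip := by
      obtain ⟨φ, hφz, hφN⟩ := Submodule.exists_dual_map_eq_bot_of_notMem hzN inferInstance
      refine ⟨φ, ?_, ?_⟩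
      · rw [Submodule.mem_dualAnnihilator]
        intro x hx
        have : φ x ∈ N.map φ := ⟨x, hx, rfl⟩
        rwa [hφN, Submodule.mem_bot] at this
      · rintro ⟨x, rfl⟩
        apply hφz
        simp [hz]
    have adjust : ∀ C : V →ₗ[k] V →ₗ[k] k, C v v ≠ 0 → C v ∈ N.dualAnnihilator →
        (∃ φ ∈ N.dualAnnihilator, φ ∉ LinearMap.range C) →
        ∃ φ ∈ N.dualAnnihilator, φ v = 0 ∧ φ ∉ LinearMap.range C := by
      rintro C hC hCN ⟨φ, hφ, hφC⟩
      refine ⟨φ - (φ v / C v v) • C v, ?_, by simp [hC], fun h => hφC ?_⟩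
      · exact Submodule.sub_mem _ hφ (Submodule.smul_mem _ _ hCN)
      · have := Submodule.add_mem _ h
          (Submodule.smul_mem _ (φ v / C v v) (LinearMap.mem_range_self C v))
        simpa using this
    obtain ⟨φ₁, h₁, h₁v, h₁L⟩ := adjust B hv (memD v).1 hL
    obtain ⟨φ₂, h₂, h₂v, h₂R⟩ := adjust B.flip hv (memD v).2 hR
    obtain ⟨φ, hφN, hφv, hφL, hφR⟩ : ∃ φ ∈ N.dualAnnihilator, φ v = 0 ∧
        φ ∉ LinearMap.range B ∧ φ ∉ LinearMap.range B.flip := by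
      by_cases h₁R : φ₁ ∈ LinearMap.range B.flip
      · by_cases h₂L : φ₂ ∈ LinearMap.range B
        · refine ⟨φ₁ + φ₂, Submodule.add_mem _ h₁ h₂, by simp [h₁v, h₂v], ?_, ?_⟩
          · rwa [Submodule.add_mem_iff_left _ h₂L]
          · rwa [Submodule.add_mem_iff_right _ h₁R]
        · exact ⟨φ₂, h₂, h₂v, h₂L, h₂R⟩
      · exact ⟨φ₁, h₁, h₁v, h₁L, h₁R⟩
    have hφ0 : φ ≠ 0 := fun h => hφL (h ▸ Submodule.zero_mem _)
    obtain ⟨w, hw⟩ : ∃ w, φ w ≠ 0 := by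
      by_contra! h
      exact hφ0 (LinearMap.ext h)
    have eq_zero : ∀ (C : V →ₗ[k] V →ₗ[k] k) (x : V), φ ∉ LinearMap.range C →
        (∀ y, φ y = 0 → C x y = 0) → C x = 0 := by
      intro C x hC h
      obtain ⟨a, ha⟩ := proportional φ (C x) w hw h
      rcases eq_or_ne a 0 with rfl | ha0
      · simpa using ha
      · exact absurd ⟨a⁻¹ • x, by rw [map_smul, ha, inv_smul_smul₀ ha0]⟩ hC
    refine ⟨φ, v, (φ w)⁻¹ • w, by simp [hw], hφv, hv,
      (Submodule.mem_dualAnnihilator φ).1 hφN, fun x _ hx => (hN x).2 fun y => ⟨?_, ?_⟩⟩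
    · rw [eq_zero B x hφL fun y hy => (hx y hy).1, LinearMap.zero_apply]
    · rw [← LinearMap.flip_apply, eq_zero B.flip x hφR fun y hy => (hx y hy).2,
        LinearMap.zero_apply]
  · push Not at hker
    suffices ∃ x u, B x x ≠ 0 ∧ B x u = 0 ∧ B u u ≠ 0 by
      obtain ⟨x, u, hx, hxu, hu⟩ := this
      refine ⟨B x, u, (B x x)⁻¹ • x, by simp [hx], hxu, hu, fun y hy => ((hN y).1 hy x).2,
        fun z hz hrad => ?_⟩
      have hmem : z - (B z x / B x x) • x ∈ N := by
        refine hker _ (LinearMap.ext fun y => ?_)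
        have := (hrad (y - (B x y / B x x) • x) (by simp [hx])).1
        simp only [map_sub, map_smul, smul_eq_mul] at this
        simp only [map_sub, map_smul, LinearMap.sub_apply, LinearMap.smul_apply, smul_eq_mul,
          LinearMap.zero_apply]
        rw [← this]
        ring
      have h0 := ((hN _).1 hmem x).2
      simp only [map_sub, map_smul, smul_eq_mul, hz] at h0
      rw [div_mul_cancel₀ _ hx, zero_sub, neg_eq_zero] at h0
      simpa [h0] using hmem
    by_cases hQ : ∃ u, B v u = 0 ∧ B u u ≠ 0
    · obtain ⟨u, hu⟩ := hQ
      exact ⟨v, u, hv, hu⟩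
    push Not at hQ
    obtain ⟨y, hvy, hyN⟩ : ∃ y, B v y = 0 ∧ y ∉ N := by
      by_contra! hcon
      have h1 : finrank k (LinearMap.ker (B v)) ≤ finrank k N :=
        Submodule.finrank_mono fun y hy => hcon y hy
      have h2 := LinearMap.finrank_range_add_finrank_ker (B v)
      have h3 := Submodule.finrank_le (LinearMap.range (B v))
      rw [finrank_self] at h3
      omega
    obtain ⟨y', hvy', hyy'⟩ : ∃ y', B v y' = 0 ∧ B y y' ≠ 0 := by
      by_contra! hcon
      have hmem : y - (B y v / B v v) • v ∈ N := by
        refine hker _ (LinearMap.ext fun z => ?_)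
        have := hcon (z - (B v z / B v v) • v) (by simp [hv])
        simp only [map_sub, map_smul, smul_eq_mul] at this
        simp only [map_sub, map_smul, LinearMap.sub_apply, LinearMap.smul_apply, smul_eq_mul,
          LinearMap.zero_apply]
        rw [← this]
        ring
      have h0 := ((hN _).1 hmem v).2
      simp only [map_sub, map_smul, smul_eq_mul, hvy] at h0
      rw [div_mul_cancel₀ _ hv, zero_sub, neg_eq_zero] at h0
      exact hyN (by simpa [h0] using hmem)
    have hQy := hQ y hvy
    have hQy' := hQ y' hvy'
    set c := B v v
    set b := B y v
    set b' := B y' v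
    set d := B y y'
    classical
    obtain ⟨s, hs⟩ := Infinite.exists_notMem_finset
      ({0, -c / b, b' * c / (c * d - b * b')} : Finset k)
    simp only [Finset.mem_insert, Finset.mem_singleton, not_or] at hs
    obtain ⟨hs0, hs1, hs2⟩ := hs
    have hx : c + s * b ≠ 0 := by
      intro h
      rcases eq_or_ne b 0 with hb | hb
      · simp [hb] at h
        exact hv h
      · exact hs1 (by rw [eq_div_iff hb]; linear_combination h)
    have hu : s * (c * d - b * b') ≠ b' * c := by
      intro h
      rcases eq_or_ne (c * d - b * b') 0 with h0 | h0
      · rw [h0, mul_zero] at h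
        have hb' : b' = 0 := by
          rcases mul_eq_zero.1 h.symm with h | h
          · exact h
          · exact absurd h hv
        rw [hb', mul_zero, sub_zero] at h0
        exact mul_ne_zero hv hyy' h0
      · exact hs2 (by rw [eq_div_iff h0]; exact h)
    refine ⟨v + s • y, v + (-(c + s * b) / (s * d)) • y', ?_, ?_, ?_⟩
    · simpa [hvy, hQy, c, b] using hx
    · have : c + s * b + (-(c + s * b) / (s * d)) * (s * d) = 0 := by
        rw [div_mul_cancel₀ _ (mul_ne_zero hs0 hyy')]
        ring
      simp only [map_add, map_smul, LinearMap.add_apply, LinearMap.smul_apply, smul_eq_mul, hvy']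
      linear_combination this
    · simp only [map_add, map_smul, LinearMap.add_apply, LinearMap.smul_apply, smul_eq_mul, hvy',
        hQy', mul_zero, add_zero]
      intro h
      apply hu
      have h' : c + -(c + s * b) / (s * d) * b' = 0 := by linear_combination h
      field_simp at h'
      linear_combination h'

theorem degenerates_of_quadratic_family [Infinite k] {n : ℕ} {μ A C D : AlgStr k n}
    (h : ∀ t : k, t ≠ 0 → A + t • C + t ^ 2 • D ∈ orbit μ) : degenerates μ A := by
  rintro T ⟨P, hP⟩ hT
  refine (hP A).2 fun p hp => ?_
  set q : Polynomial k := MvPolynomial.aeval (fun i => Polynomial.C (structConst A i) +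
    Polynomial.X * Polynomial.C (structConst C i) +
    Polynomial.X ^ 2 * Polynomial.C (structConst D i)) p with hq
  have heval : ∀ t, q.eval t = MvPolynomial.eval (structConst (A + t • C + t ^ 2 • D)) p := by
    intro t
    rw [hq, ← Polynomial.coe_evalRingHom, MvPolynomial.aeval_def, MvPolynomial.hom_eval₂,
      MvPolynomial.eval, MvPolynomial.coe_eval₂Hom]
    congr 1
    · ext a
      simp
    · funext i
      simp only [structConst, LinearMap.add_apply, LinearMap.smul_apply, Pi.add_apply,
        Pi.smul_apply, smul_eq_mul, Polynomial.coe_evalRingHom, Polynomial.eval_add,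
        Polynomial.eval_mul, Polynomial.eval_C, Polynomial.eval_X, Polynomial.eval_pow]
  have hzero : q = 0 := by
    refine Polynomial.eq_zero_of_infinite_isRoot q
      ((Set.finite_singleton (0 : k)).infinite_compl.mono ?_)
    intro t ht
    exact (heval t).trans ((hP _).1 (hT (h t ht)) p hp)
  simpa [hzero] using (heval 0).symm

theorem finrank_annihilator_eq_of_mem_orbit {n : ℕ} {μ χ : AlgStr k n} (h : χ ∈ orbit μ) :
    Module.finrank k (annihilator χ) = Module.finrank k (annihilator μ) := by
  obtain ⟨g, rfl⟩ := h
  have : annihilator (transport g μ) = (annihilator μ).map (g : (Fin n → k) →ₗ[k] (Fin n → k)) := by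
    ext x
    rw [Submodule.mem_map_equiv]
    change (∀ b, g (μ (g.symm x) (g.symm b)) = 0 ∧ g (μ (g.symm b) (g.symm x)) = 0) ↔
      ∀ b, μ (g.symm x) b = 0 ∧ μ b (g.symm x) = 0
    simp only [LinearEquiv.map_eq_zero_iff]
    exact g.symm.surjective.forall (p := fun b => μ (g.symm x) b = 0 ∧ μ b (g.symm x) = 0) |>.symm
  rw [this]
  exact LinearEquiv.finrank_map_eq g (annihilator μ)

theorem hasChain.succ {n : ℕ} {μ ν : AlgStr k n} {m : ℕ} (h : properlyDegenerates μ ν)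
    (hν : hasChain ν m) : hasChain μ (m + 1) := by
  obtain ⟨c, hc, hstep⟩ := hν
  refine ⟨fun i => if i = m + 1 then μ else c i, by simp, fun i hi => ?_⟩
  rcases (Nat.lt_succ_iff_lt_or_eq.1 hi) with hlt | rfl
  · have h1 : i + 1 ≠ m + 1 := by omega
    have h2 : i ≠ m + 1 := by omega
    simpa only [h1, h2, if_false] using hstep i hlt
  · simpa [hc] using h

theorem properlyDegenerates_zero [Infinite k] {n : ℕ} {μ : AlgStr k n} (hμ : μ ≠ 0) :
    properlyDegenerates μ 0 := by
  refine ⟨degenerates_of_quadratic_family (C := μ) (D := 0) fun t ht => ?_, ?_⟩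
  · refine ⟨(LinearEquiv.smulOfNeZero k (Fin n → k) t ht).symm, ?_⟩
    refine LinearMap.ext₂ fun x y => ?_
    change (LinearEquiv.smulOfNeZero k (Fin n → k) t ht).symm (μ (t • x) (t • y)) = _
    rw [LinearEquiv.symm_apply_eq]
    simp
  · rintro ⟨g, hg⟩
    apply hμ
    refine LinearMap.ext₂ fun x y => ?_
    have := congrArg (fun ν : AlgStr k n => ν (g x) (g y)) hg
    simpa [transport] using this

/-- Precomposition of `μ` with the projection along `w` onto the hyperplane `ker φ`. -/
theorem degenerates_compl₁₂_projection [Infinite k] {n : ℕ} {μ : AlgStr k n}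
    {B : (Fin n → k) →ₗ[k] (Fin n → k) →ₗ[k] k} {e : Fin n → k}
    (hμ : ∀ x y, μ x y = B x y • e) {φ : (Fin n → k) →ₗ[k] k} {w : Fin n → k} (hw : φ w = 1)
    (he : φ e = 0) :
    degenerates μ (μ.compl₁₂ (LinearMap.id - φ.smulRight w) (LinearMap.id - φ.smulRight w)) := by
  set Q := φ.smulRight w with hQ
  refine degenerates_of_quadratic_family
    (C := μ.compl₁₂ (LinearMap.id - Q) Q + μ.compl₁₂ Q (LinearMap.id - Q))
    (D := μ.compl₁₂ Q Q) fun t ht => ?_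
  let f : k → (Fin n → k) →ₗ[k] (Fin n → k) := fun t => LinearMap.id - Q + t • Q
  have hf : ∀ s t : k, s * t = 1 → f s ∘ₗ f t = LinearMap.id := by
    intro s t hst
    refine LinearMap.ext fun x => ?_
    simp only [f, hQ, LinearMap.comp_apply, LinearMap.add_apply, LinearMap.sub_apply,
      LinearMap.smul_apply, LinearMap.smulRight_apply, LinearMap.id_apply, map_add, map_sub,
      map_smul, hw]
    match_scalars
    · ring
    · linear_combination φ x * hst
  let h : (Fin n → k) ≃ₗ[k] (Fin n → k) := LinearEquiv.ofLinearMap (f t) (f t⁻¹)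
    (hf _ _ (mul_inv_cancel₀ ht)) (hf _ _ (inv_mul_cancel₀ ht))
  have hh : ∀ x, h x = x - φ x • w + t • φ x • w := fun x => rfl
  have hhe : h.symm e = e := by
    rw [LinearEquiv.symm_apply_eq, hh]
    simp [he]
  refine ⟨h.symm, LinearMap.ext₂ fun x y => ?_⟩
  change h.symm (μ (h x) (h y)) = _
  rw [hμ, map_smul, hhe, ← hμ, hh, hh]
  simp only [hQ, map_add, map_sub, map_smul, LinearMap.add_apply, LinearMap.sub_apply,
    LinearMap.smul_apply, LinearMap.compl₁₂_apply, LinearMap.smulRight_apply, LinearMap.id_apply]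
  module

theorem hasChain_of_bilinear_form [Infinite k] {n : ℕ} (m : ℕ) (μ : AlgStr k n)
    (B : (Fin n → k) →ₗ[k] (Fin n → k) →ₗ[k] k) (e : Fin n → k)
    (hμ : ∀ x y, μ x y = B x y • e) (he : e ∈ annihilator μ) (hna : ∃ v, μ v v ≠ 0)
    (hm : Module.finrank k (annihilator μ) + m ≤ n) : hasChain μ m := by
  induction m generalizing μ B with
  | zero => exact ⟨fun _ => μ, rfl, by simp⟩
  | succ m ih =>
    obtain ⟨v, hv⟩ := hna
    rcases Nat.eq_zero_or_pos m with rfl | hmpos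
    · refine hasChain.succ (properlyDegenerates_zero ?_) ⟨fun _ => 0, rfl, by simp⟩
      rintro rfl
      exact hv rfl
    have he0 : e ≠ 0 := by
      rintro rfl
      simp [hμ] at hv
    have hN : ∀ x, x ∈ annihilator μ ↔ ∀ y, B x y = 0 ∧ B y x = 0 := by
      intro x
      change (∀ b, μ x b = 0 ∧ μ b x = 0) ↔ _
      simp [hμ, he0]
    obtain ⟨φ, u, w, hw, hu, hBu, hφN, hrad⟩ := exists_hyperplane_radical_eq B (annihilator μ) hN
      (by rw [Module.finrank_fin_fun]; omega) ⟨v, fun h => hv (by simp [hμ, h])⟩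
    set P : (Fin n → k) →ₗ[k] (Fin n → k) := LinearMap.id - φ.smulRight w with hP
    have hPx : ∀ x, P x = x - φ x • w := fun x => rfl
    have hφP : ∀ x, φ (P x) = 0 := fun x => by simp [hPx, hw]
    have hPfix : ∀ x, φ x = 0 → P x = x := fun x hx => by simp [hPx, hx]
    have hPw : P w = 0 := by simp [hPx, hw]
    set ν : AlgStr k n := μ.compl₁₂ P P with hν
    have hνapp : ∀ x y, ν x y = μ (P x) (P y) := fun x y => rfl
    have hle : annihilator μ ≤ annihilator ν := fun x hx b => by
      rw [hνapp, hνapp, hPfix x (hφN x hx)]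
      exact ⟨(hx (P b)).1, (hx (P b)).2⟩
    have hwν : w ∈ annihilator ν := fun b => by simp [hνapp, hPw]
    have hwμ : w ∉ annihilator μ := fun h => one_ne_zero (hw.symm.trans (hφN w h))
    have hann : annihilator ν ≤ annihilator μ ⊔ Submodule.span k {w} := by
      intro x hx
      have hPxmem : P x ∈ annihilator μ := by
        refine hrad _ (hφP x) fun y hy => ?_
        have := hx y
        rw [hνapp, hνapp, hPfix y hy, hμ, hμ] at this
        simpa [he0] using this
      have hsum : x = P x + φ x • w := by simp [hPx]
      rw [hsum]
      exact Submodule.add_mem_sup hPxmem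
        (Submodule.smul_mem _ _ (Submodule.mem_span_singleton_self w))
    have hlt : Module.finrank k (annihilator μ) < Module.finrank k (annihilator ν) :=
      Submodule.finrank_lt_finrank_of_lt
        (lt_of_le_of_ne hle fun h => hwμ (h ▸ hwν))
    have hbound : Module.finrank k (annihilator ν) ≤ Module.finrank k (annihilator μ) + 1 :=
      (Submodule.finrank_mono hann).trans <|
        (Submodule.finrank_add_le_finrank_add_finrank _ _).trans <|
          Nat.add_le_add_left ((finrank_span_le_card {w}).trans (by simp)) _
    refine hasChain.succ ⟨degenerates_compl₁₂_projection hμ hw (hφN e he), fun h => ?_⟩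
      (ih ν (B.compl₁₂ P P) (fun x y => hμ _ _) (hle he) ⟨u, ?_⟩ (by omega))
    · exact hlt.ne' (finrank_annihilator_eq_of_mem_orbit h)
    · rw [hνapp, hPfix u hu, hμ]
      exact smul_ne_zero hBu he0

/-! ## STATEMENT 17 -/
theorem stmt17 {k : Type*} [Field k] [IsAlgClosed k] (n : ℕ) (μ : AlgStr k n)
    (hform : ∀ t : Fin n × Fin n × Fin n,
      ¬ ((t.1 : ℕ) < n - 1 ∧ (t.2.1 : ℕ) < n - 1 ∧ (t.2.2 : ℕ) = n - 1) →
      structConst μ t = 0)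
    (hna : ∃ v : Fin n → k, μ v v ≠ 0) :
    hasChain μ (n - Module.finrank k ↥(annihilator μ)) := by
  have hn : 0 < n := by
    rcases Nat.eq_zero_or_pos n with rfl | h
    · obtain ⟨v, hv⟩ := hna
      exact absurd (Subsingleton.elim _ _) hv
    · exact h
  let last : Fin n := ⟨n - 1, by omega⟩
  let e : Fin n → k := Pi.single last 1
  have hlast : ∀ m : Fin n, (m : ℕ) = n - 1 ↔ m = last := fun m => (Fin.ext_iff (b := last)).symm
  have hzero : ∀ i j m : Fin n, i = last ∨ j = last ∨ m ≠ last →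
      μ (Pi.single i 1) (Pi.single j 1) m = 0 := by
    intro i j m h
    refine hform (i, j, m) ?_
    rintro ⟨hi, hj, hm⟩
    rcases h with rfl | rfl | h
    · exact lt_irrefl _ hi
    · exact lt_irrefl _ hj
    · exact h ((hlast m).1 hm)
  let B : (Fin n → k) →ₗ[k] (Fin n → k) →ₗ[k] k := μ.compr₂ (LinearMap.proj last)
  have hμ : μ = B.compr₂ (LinearMap.toSpanSingleton k _ e) := by
    refine (Pi.basisFun k (Fin n)).ext fun i => (Pi.basisFun k (Fin n)).ext fun j => ?_
    funext m
    simp only [Pi.basisFun_apply]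
    change _ = (μ (Pi.single i 1) (Pi.single j 1) last • e) m
    rcases eq_or_ne m last with rfl | hm
    · simp [e]
    · simp [e, hm, hzero i j m (Or.inr (Or.inr hm))]
  have hleft : μ e = 0 := by
    refine (Pi.basisFun k (Fin n)).ext fun j => funext fun m => ?_
    rw [Pi.basisFun_apply]
    exact hzero last j m (Or.inl rfl)
  have hright : μ.flip e = 0 := by
    refine (Pi.basisFun k (Fin n)).ext fun i => funext fun m => ?_
    rw [Pi.basisFun_apply]
    exact hzero i last m (Or.inr (Or.inl rfl))
  refine hasChain_of_bilinear_form _ μ B e (fun x y => ?_)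
    (fun b => ⟨LinearMap.congr_fun hleft b, LinearMap.congr_fun hright b⟩) hna ?_
  · conv_lhs => rw [hμ]
    rfl
  · have := Submodule.finrank_le (annihilator μ)
    rw [Module.finrank_fin_fun] at this
    omega


end
end
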